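/- arXiv:1809.00134 — 5 statements merged into one kernel-verified Lean document; each statement's English description precedes it below -/
import Mathlib

section
/- Let (T, Σ_C) be a safe EL TBox with closed predicates. Then for every UCQ q, every ABox A that is consistent w.r.t. (T, Σ_C), and every tuple a⃗ from Ind(A): A ⊨ (T, Σ_C, q)(a⃗) iff A ⊨ (T, ∅, q)(a⃗). -/
namespace DL

/-- Roles: role names or inverse roles.  Role names are natural numbers. -/
inductive Role : Type
  | nm (r : ℕ) : Role
  | inv (r : ℕ) : Role
  deriving DecidableEq

/-- The inverse of a role. -/
def Role.flip : Role → Role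
  | .nm r => .inv r
  | .inv r => .nm r

/-- The role name occurring in a role. -/
def Role.name : Role → ℕ
  | .nm r => r
  | .inv r => r

/-- Interpretations.  Concept names, role names, and individual names are natural
numbers.  The standard name assumption is modelled by a partial, injective
interpretation `ind` of individual names: `ind a = some d` means that the individual
name `a` belongs to the domain and is (identified with) the element `d`. -/
structure Interp : Type 1 where
  Dom : Type
  dne : Nonempty Dom
  ind : ℕ → Option Dom
  ind_inj : ∀ a b d, ind a = some d → ind b = some d → a = b
  cInt : ℕ → Set Dom
  rInt : ℕ → Set (Dom × Dom)

/-- Extension of a (possibly inverse) role. -/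
def Interp.rI (I : Interp) : Role → Set (I.Dom × I.Dom)
  | .nm r => I.rInt r
  | .inv r => {p | (p.2, p.1) ∈ I.rInt r}

/-- ABoxes: sets of concept assertions `(A, a)` and role assertions `(r, a, b)`. -/
structure ABox : Type where
  ca : Set (ℕ × ℕ)
  ra : Set (ℕ × ℕ × ℕ)

/-- The individual names occurring in an ABox. -/
def ABox.ind (A : ABox) : Set ℕ :=
  {a | (∃ p ∈ A.ca, p.2 = a) ∨ (∃ t ∈ A.ra, t.2.1 = a ∨ t.2.2 = a)}

/-- The ABox is finite. -/
def ABox.Fin (A : ABox) : Prop := A.ca.Finite ∧ A.ra.Finite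

/-- The ABox only uses concept names from `Sc` and role names from `Sr`
(i.e. it is a `S`-ABox for the signature `S = Sc ∪ Sr`). -/
def ABox.usesOnly (A : ABox) (Sc Sr : Set ℕ) : Prop :=
  (∀ p ∈ A.ca, p.1 ∈ Sc) ∧ (∀ t ∈ A.ra, t.1 ∈ Sr)

/-- `I` is a model of the ABox `A` (under the standard name assumption). -/
def Interp.modelA (I : Interp) (A : ABox) : Prop :=
  (∀ p ∈ A.ca, ∃ d, I.ind p.2 = some d ∧ d ∈ I.cInt p.1) ∧
  (∀ t ∈ A.ra, ∃ d e, I.ind t.2.1 = some d ∧ I.ind t.2.2 = some e ∧ (d, e) ∈ I.rInt t.1)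

/-- `I` respects the closed predicates `Sc` (concept names) and `Sr` (role names)
with respect to the ABox `A`: the extension of each closed predicate is exactly
what is asserted in `A`. -/
def Interp.respects (I : Interp) (A : ABox) (Sc Sr : Set ℕ) : Prop :=
  (∀ B ∈ Sc, ∀ d, d ∈ I.cInt B ↔ ∃ a, I.ind a = some d ∧ (B, a) ∈ A.ca) ∧
  (∀ r ∈ Sr, ∀ d e, (d, e) ∈ I.rInt r ↔ ∃ a b, I.ind a = some d ∧ I.ind b = some e ∧ (r, a, b) ∈ A.ra)

/-- First-order queries built from concept atoms, role atoms and equality using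
negation, conjunction, disjunction and existential quantification.
Variables are natural numbers. -/
inductive FO : Type
  | eq (x y : ℕ)
  | capp (B x : ℕ)
  | rapp (r x y : ℕ)
  | neg (φ : FO)
  | conj (φ ψ : FO)
  | disj (φ ψ : FO)
  | ex (x : ℕ) (φ : FO)

/-- Standard first-order evaluation of a query in an interpretation under an
assignment. -/
def Interp.evalFO (I : Interp) : (ℕ → I.Dom) → FO → Prop
  | v, .eq x y => v x = v y
  | v, .capp B x => v x ∈ I.cInt B
  | v, .rapp r x y => (v x, v y) ∈ I.rInt r
  | v, .neg φ => ¬ I.evalFO v φ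
  | v, .conj φ ψ => I.evalFO v φ ∧ I.evalFO v ψ
  | v, .disj φ ψ => I.evalFO v φ ∨ I.evalFO v ψ
  | v, .ex x φ => ∃ d : I.Dom, I.evalFO (Function.update v x d) φ

/-- Free variables of a first-order query. -/
def FO.free : FO → Set ℕ
  | .eq x y => {x, y}
  | .capp _ x => {x}
  | .rapp _ x y => {x, y}
  | .neg φ => φ.free
  | .conj φ ψ => φ.free ∪ ψ.free
  | .disj φ ψ => φ.free ∪ ψ.free
  | .ex x φ => φ.free \ {x}

/-- Conjunctions of concept and role atoms. -/
inductive IsConjAtoms : FO → Prop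
  | capp (B x : ℕ) : IsConjAtoms (.capp B x)
  | rapp (r x y : ℕ) : IsConjAtoms (.rapp r x y)
  | conj {φ ψ : FO} : IsConjAtoms φ → IsConjAtoms ψ → IsConjAtoms (.conj φ ψ)

/-- Conjunctive queries: existentially quantified conjunctions of atoms. -/
inductive IsCQ : FO → Prop
  | base {φ : FO} : IsConjAtoms φ → IsCQ φ
  | ex {φ : FO} (x : ℕ) : IsCQ φ → IsCQ (.ex x φ)

/-- Unions of conjunctive queries: disjunctions of CQs. -/
inductive IsUCQ : FO → Prop
  | base {φ : FO} : IsCQ φ → IsUCQ φ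
  | disj {φ ψ : FO} : IsUCQ φ → IsUCQ ψ → IsUCQ (.disj φ ψ)

/-- `v` maps the answer variables `xs` to (the domain elements named by) the
individual names `as`. -/
def matches' (I : Interp) (xs as : List ℕ) (v : ℕ → I.Dom) : Prop :=
  ∀ p ∈ List.zip xs as, I.ind p.2 = some (v p.1)

/-- `I ⊨ q(as)`, where `xs` is the list of answer variables of `q`. -/
def Interp.sat (I : Interp) (q : FO) (xs as : List ℕ) : Prop :=
  ∃ v : ℕ → I.Dom, matches' I xs as v ∧ I.evalFO v q

/-- Certain answers of the ontology-mediated query with closed predicates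
`(T, Σ_C, q)` where the models of the TBox `T` are given by the predicate `mod`:
`as` is a certain answer to `q` (with answer variables `xs`) over `A` iff every
model of the TBox and `A` that respects the closed predicates satisfies `q(as)`. -/
def certAns (mod : Interp → Prop) (Sc Sr : Set ℕ) (A : ABox) (q : FO) (xs as : List ℕ) : Prop :=
  ∀ I : Interp, mod I → I.modelA A → I.respects A Sc Sr → I.sat q xs as

/-- `A` is consistent w.r.t. the TBox (given by `mod`) and the closed predicates. -/
def consistentW (mod : Interp → Prop) (Sc Sr : Set ℕ) (A : ABox) : Prop :=
  ∃ I : Interp, mod I ∧ I.modelA A ∧ I.respects A Sc Sr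

/-- EL concepts. -/
inductive EL : Type
  | atom (B : ℕ)
  | top
  | conj (C D : EL)
  | ex (r : ℕ) (C : EL)
  deriving DecidableEq

/-- Semantics of EL concepts. -/
def Interp.semE (I : Interp) : EL → Set I.Dom
  | .atom B => I.cInt B
  | .top => Set.univ
  | .conj C D => I.semE C ∩ I.semE D
  | .ex r C => {d | ∃ e, (d, e) ∈ I.rInt r ∧ e ∈ I.semE C}

/-- An EL TBox is a finite list of concept inclusions `C ⊑ D`. -/
abbrev ELTBox := List (EL × EL)

/-- `I` is a model of the EL TBox `T`. -/
def Interp.modelEL (I : Interp) (T : ELTBox) : Prop :=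
  ∀ p ∈ T, I.semE p.1 ⊆ I.semE p.2

/-- `T ⊨ C ⊑ D` for EL concepts. -/
def elEnt (T : ELTBox) (C D : EL) : Prop :=
  ∀ I : Interp, I.modelEL T → I.semE C ⊆ I.semE D

/-- Concept names occurring in an EL concept. -/
def EL.sigC : EL → Set ℕ
  | .atom B => {B}
  | .top => ∅
  | .conj C D => C.sigC ∪ D.sigC
  | .ex _ C => C.sigC

/-- Role names occurring in an EL concept. -/
def EL.sigR : EL → Set ℕ
  | .atom _ => ∅
  | .top => ∅
  | .conj C D => C.sigR ∪ D.sigR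
  | .ex r C => insert r C.sigR

/-- `E.isTlc C` : `E` is a top-level conjunct of `C`. -/
def EL.isTlc : EL → EL → Prop
  | E, .conj C D => E = .conj C D ∨ E.isTlc C ∨ E.isTlc D
  | E, C => E = C

/-- Subconcepts of an EL concept (including the concept itself). -/
def EL.subs : EL → Set EL
  | .atom B => {.atom B}
  | .top => {.top}
  | .conj C D => insert (.conj C D) (C.subs ∪ D.subs)
  | .ex r C => insert (.ex r C) C.subs

/-- `sub(T)`: subconcepts of concepts occurring in the EL TBox `T`. -/
def elSubsT (T : ELTBox) : Set EL :=
  {E | ∃ p ∈ T, E ∈ p.1.subs ∪ p.2.subs}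

/-- Concept names occurring in an EL TBox. -/
def elTSigC (T : ELTBox) : Set ℕ :=
  {B | ∃ p ∈ T, B ∈ p.1.sigC ∪ p.2.sigC}

/-- Role names occurring in an EL TBox. -/
def elTSigR (T : ELTBox) : Set ℕ :=
  {r | ∃ p ∈ T, r ∈ p.1.sigR ∪ p.2.sigR}

/-- Safeness of an EL TBox with closed predicates `(T, S_C)`, where `S_C`
consists of the concept names `Sc` and the role names `Sr`. -/
def ELSafe (T : ELTBox) (Sc Sr : Set ℕ) : Prop :=
  ¬ ∃ (C : EL) (r : ℕ) (D : EL),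
      -- (1)
      elEnt T C (.ex r D) ∧
      -- (2)
      (¬ ∃ C' : EL, EL.isTlc (.ex r C') C ∧ elEnt T C' D) ∧
      -- (3)
      ( -- (s1)
        (r ∉ Sr ∧ ((D.sigC ∩ Sc).Nonempty ∨ (D.sigR ∩ Sr).Nonempty)) ∨
        -- (s2)
        (r ∈ Sr ∧ ¬ (D.sigC ⊆ Sc ∧ D.sigR ⊆ Sr) ∧
          ¬ ∃ E : EL, E.sigC ⊆ Sc ∧ E.sigR ⊆ Sr ∧ elEnt T C (.ex r E) ∧ elEnt T E D) )

/-- Homomorphisms between interpretations, ignoring individual names. -/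
structure IsHom_s10 (I J : Interp) (f : I.Dom → J.Dom) : Prop where
  cInt : ∀ B d, d ∈ I.cInt B → f d ∈ J.cInt B
  rInt : ∀ r d e, (d, e) ∈ I.rInt r → (f d, f e) ∈ J.rInt r

lemma IsHom_s10.semE {I J : Interp} {f : I.Dom → J.Dom} (hf : IsHom_s10 I J f) (C : EL) :
    ∀ d, d ∈ I.semE C → f d ∈ J.semE C := by
  induction C with
  | atom B => exact hf.cInt B
  | top => exact fun _ _ => trivial
  | conj C D hC hD => exact fun d hd => ⟨hC d hd.1, hD d hd.2⟩
  | ex r C hC =>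
    rintro d ⟨e, hde, he⟩
    exact ⟨f e, hf.rInt r d e hde, hC e he⟩

lemma IsHom_s10.evalFO_of_isConjAtoms {I J : Interp} {f : I.Dom → J.Dom} (hf : IsHom_s10 I J f)
    {φ : FO} (hφ : IsConjAtoms φ) (v : ℕ → I.Dom) (h : I.evalFO v φ) :
    J.evalFO (f ∘ v) φ := by
  induction hφ with
  | capp B x => exact hf.cInt _ _ h
  | rapp r x y => exact hf.rInt _ _ _ h
  | conj _ _ h₁ h₂ => exact ⟨h₁ h.1, h₂ h.2⟩

lemma IsHom_s10.evalFO_of_isCQ {I J : Interp} {f : I.Dom → J.Dom} (hf : IsHom_s10 I J f)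
    {φ : FO} (hφ : IsCQ φ) (v : ℕ → I.Dom) (h : I.evalFO v φ) :
    J.evalFO (f ∘ v) φ := by
  induction hφ generalizing v with
  | base hφ => exact hf.evalFO_of_isConjAtoms hφ v h
  | ex x _ ih =>
    obtain ⟨d, hd⟩ := h
    refine ⟨f d, ?_⟩
    rw [← Function.comp_update]
    exact ih _ hd

lemma IsHom_s10.evalFO_of_isUCQ {I J : Interp} {f : I.Dom → J.Dom} (hf : IsHom_s10 I J f)
    {φ : FO} (hφ : IsUCQ φ) (v : ℕ → I.Dom) (h : I.evalFO v φ) :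
    J.evalFO (f ∘ v) φ := by
  induction hφ with
  | base hφ => exact hf.evalFO_of_isCQ hφ v h
  | disj _ _ h₁ h₂ => exact h.imp h₁ h₂

lemma EL.isTlc.semE_subset {E C : EL} (h : E.isTlc C) (I : Interp) :
    I.semE C ⊆ I.semE E := by
  induction C with
  | conj C D hC hD =>
    rcases h with rfl | h | h
    · exact subset_rfl
    · exact fun d hd => hC h hd.1
    · exact fun d hd => hD h hd.2
  | _ => cases h; exact subset_rfl

lemma elEnt.trans {T : ELTBox} {C D E : EL} (h₁ : elEnt T C D) (h₂ : elEnt T D E) :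
    elEnt T C E :=
  fun I hI => (h₁ I hI).trans (h₂ I hI)

lemma elEnt.refl (T : ELTBox) (C : EL) : elEnt T C C :=
  fun _ _ => subset_rfl

lemma elEnt.ex {T : ELTBox} {C D : EL} (r : ℕ) (h : elEnt T C D) :
    elEnt T (.ex r C) (.ex r D) :=
  fun I hI _ ⟨e, hde, he⟩ => ⟨e, hde, h I hI he⟩

/-- The concept `D` entails no concept that mentions a closed predicate. -/
def EL.EntailsNoClosed (T : ELTBox) (Sc Sr : Set ℕ) (D : EL) : Prop :=
  ∀ F, elEnt T D F → ¬ ((F.sigC ∩ Sc).Nonempty ∨ (F.sigR ∩ Sr).Nonempty)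

/-- The restriction of the extensions in `I` to what is asserted in the ABox `A`. -/
def Interp.restrictABox (I : Interp) (A : ABox) : Interp where
  Dom := I.Dom
  dne := I.dne
  ind := I.ind
  ind_inj := I.ind_inj
  cInt B := {d | ∃ a, I.ind a = some d ∧ (B, a) ∈ A.ca}
  rInt r := {p | ∃ a b, I.ind a = some p.1 ∧ I.ind b = some p.2 ∧ (r, a, b) ∈ A.ra}

lemma Interp.isHom_restrictABox {I : Interp} {A : ABox} (hI : I.modelA A) :
    IsHom_s10 (I.restrictABox A) I id where
  cInt := by
    rintro B d ⟨a, ha, hB⟩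
    obtain ⟨d', hd', h⟩ := hI.1 _ hB
    obtain rfl : d = d' := Option.some.inj (ha.symm.trans hd')
    exact h
  rInt := by
    rintro r d e ⟨a, b, ha, hb, hr⟩
    obtain ⟨d', e', hd', he', h⟩ := hI.2 _ hr
    obtain rfl : d = d' := Option.some.inj (ha.symm.trans hd')
    obtain rfl : e = e' := Option.some.inj (hb.symm.trans he')
    exact h

lemma Interp.semE_restrictABox_of_closed {I : Interp} {A : ABox} {Sc Sr : Set ℕ}
    (hI : I.respects A Sc Sr) (E : EL) (hc : E.sigC ⊆ Sc) (hr : E.sigR ⊆ Sr) :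
    ∀ d : I.Dom, d ∈ I.semE E → d ∈ (I.restrictABox A).semE E := by
  induction E with
  | atom B => exact fun d hd => (hI.1 B (hc rfl) d).1 hd
  | top => exact fun _ _ => trivial
  | conj C D hC hD =>
    simp only [EL.sigC, EL.sigR, Set.union_subset_iff] at hc hr
    exact fun d hd => ⟨hC hc.1 hr.1 d hd.1, hD hc.2 hr.2 d hd.2⟩
  | ex r C hC =>
    simp only [EL.sigR, Set.insert_subset_iff] at hr
    rintro d ⟨e, hde, he⟩
    exact ⟨e, (hI.2 r hr.1 d e).1 hde, hC hc hr.2 e he⟩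

open Classical in
/-- The map between the domains of two interpretations that follows individual names. -/
noncomputable def Interp.followNames (I J : Interp) (d : I.Dom) : J.Dom :=
  if h : ∃ e a, I.ind a = some d ∧ J.ind a = some e then h.choose
  else Classical.choice J.dne

lemma Interp.followNames_eq {I J : Interp} {a : ℕ} {d : I.Dom} {e : J.Dom}
    (hd : I.ind a = some d) (he : J.ind a = some e) : I.followNames J d = e := by
  have h : ∃ e a, I.ind a = some d ∧ J.ind a = some e := ⟨e, a, hd, he⟩
  obtain ⟨b, h₁, h₂⟩ := h.choose_spec
  rw [I.ind_inj _ _ _ h₁ hd, he] at h₂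
  rw [followNames, dif_pos h]
  exact (Option.some.inj h₂).symm

lemma Interp.isHom_followNames {I J : Interp} {A : ABox} (hJ : J.modelA A) :
    IsHom_s10 (I.restrictABox A) J (I.followNames J) where
  cInt := by
    rintro B d ⟨a, ha, hB⟩
    obtain ⟨e, he, h⟩ := hJ.1 _ hB
    rwa [followNames_eq ha he]
  rInt := by
    rintro r d d' ⟨a, b, ha, hb, hr⟩
    obtain ⟨e, e', he, he', h⟩ := hJ.2 _ hr
    rwa [followNames_eq ha he, followNames_eq hb he']

section Completion

variable (T : ELTBox) (Sc Sr : Set ℕ) (K I : Interp) (h : K.Dom → I.Dom)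

/-- Elements of the completion of `K` along `h : K → I`: elements of `K`, and anonymous
elements, which are pairs of a concept entailing nothing about closed predicates and an
instance of that concept in `I`. -/
abbrev CompletionDom : Type :=
  K.Dom ⊕ {p : EL × I.Dom // p.1.EntailsNoClosed T Sc Sr ∧ p.2 ∈ I.semE p.1}

/-- The concepts that the completion is required to satisfy at an element. -/
def completionType : CompletionDom T Sc Sr K I → EL → Prop
  | .inl d, F => ∃ C, d ∈ K.semE C ∧ elEnt T C F
  | .inr p, F => elEnt T p.1.1 F

/-- The projection from the completion to `I`. -/
def completionProj : CompletionDom T Sc Sr K I → I.Dom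
  | .inl d => h d
  | .inr p => p.1.2

/-- The extension of `K` by anonymous elements below `I` that makes it a model of `T`
when `T` is safe. -/
def completion : Interp where
  Dom := CompletionDom T Sc Sr K I
  dne := K.dne.map .inl
  ind a := (K.ind a).map .inl
  ind_inj := by
    intro a b d ha hb
    obtain ⟨x, hx, rfl⟩ := Option.map_eq_some_iff.1 ha
    obtain ⟨y, hy, hxy⟩ := Option.map_eq_some_iff.1 hb
    cases hxy
    exact K.ind_inj a b x hx hy
  cInt B := {x | completionType T Sc Sr K I x (.atom B)}
  rInt r := {p | match p.2 with
    | .inl d' => ∃ d, p.1 = .inl d ∧ (d, d') ∈ K.rInt r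
    | .inr q => r ∉ Sr ∧ completionType T Sc Sr K I p.1 (.ex r q.1.1) ∧
        (completionProj T Sc Sr K I h p.1, q.1.2) ∈ I.rInt r}

variable {T Sc Sr K I h}

lemma completionType.mono {x : CompletionDom T Sc Sr K I} {F G : EL}
    (hx : completionType T Sc Sr K I x F) (hFG : elEnt T F G) :
    completionType T Sc Sr K I x G := by
  cases x with
  | inl d => exact hx.imp fun C hC => ⟨hC.1, hC.2.trans hFG⟩
  | inr p => exact elEnt.trans hx hFG

lemma completionType.conj {x : CompletionDom T Sc Sr K I} {F G : EL}
    (hF : completionType T Sc Sr K I x F) (hG : completionType T Sc Sr K I x G) :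
    completionType T Sc Sr K I x (.conj F G) := by
  cases x with
  | inl d =>
    obtain ⟨C, hdC, hC⟩ := hF
    obtain ⟨D, hdD, hD⟩ := hG
    exact ⟨.conj C D, ⟨hdC, hdD⟩, fun J hJ e he => ⟨hC J hJ he.1, hD J hJ he.2⟩⟩
  | inr p => exact fun J hJ e he => ⟨hF J hJ he, hG J hJ he⟩

lemma completionType_top (x : CompletionDom T Sc Sr K I) :
    completionType T Sc Sr K I x .top := by
  cases x with
  | inl d => exact ⟨.top, trivial, elEnt.refl T _⟩
  | inr p => exact fun _ _ _ _ => trivial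

lemma completionType.proj_mem (hI : I.modelEL T) (hh : IsHom_s10 K I h)
    {x : CompletionDom T Sc Sr K I} {F : EL} (hx : completionType T Sc Sr K I x F) :
    completionProj T Sc Sr K I h x ∈ I.semE F := by
  cases x with
  | inl d =>
    obtain ⟨C, hdC, hC⟩ := hx
    exact hC I hI (hh.semE C d hdC)
  | inr p => exact hx I hI p.2.2

lemma isHom_completionProj (hI : I.modelEL T) (hh : IsHom_s10 K I h) :
    IsHom_s10 (completion T Sc Sr K I h) I (completionProj T Sc Sr K I h) where
  cInt _ _ hd := completionType.proj_mem (F := .atom _) hI hh hd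
  rInt := by
    rintro r x (d' | q) hxy
    · obtain ⟨d, rfl, hd⟩ := hxy
      exact hh.rInt r d d' hd
    · exact hxy.2.2

lemma completionType_of_mem_semE (F : EL) :
    ∀ x : CompletionDom T Sc Sr K I, x ∈ (completion T Sc Sr K I h).semE F →
      completionType T Sc Sr K I x F := by
  induction F with
  | atom B => exact fun _ hx => hx
  | top => exact fun x _ => completionType_top x
  | conj F G hF hG => exact fun x hx => (hF x hx.1).conj (hG x hx.2)
  | ex r G hG =>
    rintro x ⟨d' | q, hxy, hy⟩
    · obtain ⟨d, rfl, hd⟩ := hxy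
      obtain ⟨C, hC, hCG⟩ := hG _ hy
      exact ⟨.ex r C, ⟨d', hd, hC⟩, hCG.ex r⟩
    · exact completionType.mono hxy.2.1 (elEnt.ex r (hG _ hy))

lemma mem_semE_of_completionType (hI : I.modelEL T) (hh : IsHom_s10 K I h)
    (hsafe : ELSafe T Sc Sr)
    (hclosed : ∀ r ∈ Sr, ∀ E : EL, E.sigC ⊆ Sc → E.sigR ⊆ Sr → ∀ C, elEnt T C (.ex r E) →
      K.semE C ⊆ K.semE (.ex r E))
    (F : EL) :
    ∀ x : CompletionDom T Sc Sr K I, completionType T Sc Sr K I x F →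
      x ∈ (completion T Sc Sr K I h).semE F := by
  induction F with
  | atom B => exact fun _ hx => hx
  | top => exact fun _ _ => trivial
  | conj F G hF hG =>
    exact fun x hx => ⟨hF x (hx.mono fun _ _ _ he => he.1), hG x (hx.mono fun _ _ _ he => he.2)⟩
  | ex r G hG =>
    intro x hx
    have anonymous_succ (hr : r ∉ Sr) (hopen : G.EntailsNoClosed T Sc Sr) :
        x ∈ (completion T Sc Sr K I h).semE (.ex r G) := by
      obtain ⟨e, hde, he⟩ := hx.proj_mem hI hh
      exact ⟨.inr ⟨(G, e), hopen, he⟩, ⟨hr, hx, hde⟩, hG _ (elEnt.refl T G)⟩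
    cases x with
    | inr p =>
      refine anonymous_succ (fun hr => p.2.1 _ hx (.inr ⟨r, Set.mem_insert _ _, hr⟩))
        fun F hF hmem => p.2.1 (.ex r F) (elEnt.trans hx (hF.ex r)) ?_
      exact hmem.imp id fun ⟨s, hs, hsr⟩ => ⟨s, Set.mem_insert_of_mem _ hs, hsr⟩
    | inl d =>
      obtain ⟨C, hdC, hC⟩ := hx
      have named_succ {E : EL} (hE : d ∈ K.semE (.ex r E)) (hEG : elEnt T E G) :
          Sum.inl d ∈ (completion T Sc Sr K I h).semE (.ex r G) := by
        obtain ⟨e, hde, he⟩ := hE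
        exact ⟨.inl e, ⟨d, rfl, hde⟩, hG _ ⟨E, he, hEG⟩⟩
      by_cases htlc : ∃ C' : EL, EL.isTlc (.ex r C') C ∧ elEnt T C' G
      · obtain ⟨C', hC', hG'⟩ := htlc
        exact named_succ (hC'.semE_subset K hdC) hG'
      by_cases hr : r ∈ Sr
      · by_cases hsig : G.sigC ⊆ Sc ∧ G.sigR ⊆ Sr
        · exact named_succ (hclosed r hr G hsig.1 hsig.2 C hC hdC) (elEnt.refl T G)
        · by_contra hcon
          refine hsafe ⟨C, r, G, hC, htlc, .inr ⟨hr, hsig, ?_⟩⟩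
          rintro ⟨E, hEc, hEr, hCE, hEG⟩
          exact hcon (named_succ (hclosed r hr E hEc hEr C hCE hdC) hEG)
      · refine anonymous_succ hr fun F hF hmem =>
          hsafe ⟨C, r, .conj G F, ?_, ?_, .inl ⟨hr, ?_⟩⟩
        · exact hC.trans (elEnt.ex r fun J hJ e he => ⟨he, hF J hJ he⟩)
        · rintro ⟨C', hC', hCF⟩
          exact htlc ⟨C', hC', hCF.trans fun _ _ _ he => he.1⟩
        · exact hmem.imp (fun ⟨s, hs, hs'⟩ => ⟨s, .inr hs, hs'⟩)
            fun ⟨s, hs, hs'⟩ => ⟨s, .inr hs, hs'⟩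

end Completion

/-- Below every model of a safe TBox and a consistent ABox there is a model that respects the
closed predicates. -/
lemma ELSafe.exists_respects_isHom {T : ELTBox} {Sc Sr : Set ℕ} (hsafe : ELSafe T Sc Sr)
    {A : ABox} (hcons : consistentW (fun I => I.modelEL T) Sc Sr A)
    {I : Interp} (hI : I.modelEL T) (hIA : I.modelA A) :
    ∃ (J : Interp) (f : J.Dom → I.Dom), J.modelEL T ∧ J.modelA A ∧ J.respects A Sc Sr ∧
      IsHom_s10 J I f ∧
      ∀ a d e, J.ind a = some d → I.ind a = some e → f d = e := by
  obtain ⟨I₀, hT, hA, hresp⟩ := hcons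
  have hid := Interp.isHom_restrictABox hA
  have hh : IsHom_s10 (I₀.restrictABox A) I (I₀.followNames I) := Interp.isHom_followNames hIA
  have hclosed : ∀ r ∈ Sr, ∀ E : EL, E.sigC ⊆ Sc → E.sigR ⊆ Sr → ∀ C, elEnt T C (.ex r E) →
      (I₀.restrictABox A).semE C ⊆ (I₀.restrictABox A).semE (.ex r E) :=
    fun r hr E hEc hEr C hC d hd =>
      Interp.semE_restrictABox_of_closed hresp (.ex r E) hEc (Set.insert_subset hr hEr) d
        (hC I₀ hT (hid.semE C d hd))
  refine ⟨completion T Sc Sr (I₀.restrictABox A) I (I₀.followNames I),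
    completionProj T Sc Sr _ I _, ?_, ⟨?_, ?_⟩, ⟨?_, ?_⟩, isHom_completionProj hI hh, ?_⟩
  · exact fun p hp x hx => mem_semE_of_completionType hI hh hsafe hclosed _ x
      ((completionType_of_mem_semE _ x hx).mono fun J hJ => hJ p hp)
  · rintro ⟨B, a⟩ hB
    obtain ⟨d, hd, -⟩ := hA.1 _ hB
    exact ⟨.inl d, Option.map_eq_some_iff.2 ⟨d, hd, rfl⟩, .atom B, ⟨a, hd, hB⟩, elEnt.refl T _⟩
  · rintro ⟨r, a, b⟩ hr
    obtain ⟨d, e, hd, he, -⟩ := hA.2 _ hr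
    exact ⟨.inl d, .inl e, Option.map_eq_some_iff.2 ⟨d, hd, rfl⟩,
      Option.map_eq_some_iff.2 ⟨e, he, rfl⟩, d, rfl, a, b, hd, he, hr⟩
  · intro B hB x
    constructor
    · intro hx
      cases x with
      | inl d =>
        obtain ⟨C, hdC, hC⟩ := hx
        obtain ⟨a, ha, haB⟩ := (hresp.1 B hB d).1 (hC I₀ hT (hid.semE C d hdC))
        exact ⟨a, Option.map_eq_some_iff.2 ⟨d, ha, rfl⟩, haB⟩
      | inr p => exact (p.2.1 _ hx (.inl ⟨B, rfl, hB⟩)).elim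
    · rintro ⟨a, ha, haB⟩
      obtain ⟨d, hd, rfl⟩ := Option.map_eq_some_iff.1 ha
      exact ⟨.atom B, ⟨a, hd, haB⟩, elEnt.refl T _⟩
  · intro r hr x y
    constructor
    · intro hxy
      cases y with
      | inl e =>
        obtain ⟨d, rfl, a, b, ha, hb, hab⟩ := hxy
        exact ⟨a, b, Option.map_eq_some_iff.2 ⟨d, ha, rfl⟩,
          Option.map_eq_some_iff.2 ⟨e, hb, rfl⟩, hab⟩
      | inr q => exact (hxy.1 hr).elim
    · rintro ⟨a, b, ha, hb, hab⟩
      obtain ⟨d, hd, rfl⟩ := Option.map_eq_some_iff.1 ha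
      obtain ⟨e, he, rfl⟩ := Option.map_eq_some_iff.1 hb
      exact ⟨d, rfl, a, b, hd, he, hab⟩
  · intro a d e hd he
    obtain ⟨d, hd', rfl⟩ := Option.map_eq_some_iff.1 hd
    exact Interp.followNames_eq hd' he

lemma Interp.modelA.ind_isSome {I : Interp} {A : ABox} (hI : I.modelA A) {a : ℕ}
    (ha : a ∈ A.ind) : ∃ d, I.ind a = some d := by
  rcases ha with ⟨p, hp, rfl⟩ | ⟨t, ht, rfl | rfl⟩
  · obtain ⟨d, hd, -⟩ := hI.1 p hp
    exact ⟨d, hd⟩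
  · obtain ⟨d, -, hd, -⟩ := hI.2 t ht
    exact ⟨d, hd⟩
  · obtain ⟨-, e, -, he, -⟩ := hI.2 t ht
    exact ⟨e, he⟩

/-- Let `(T, S_C)` be a safe EL TBox with closed predicates.
Then for every UCQ `q`, every (finite) ABox `A` that is consistent w.r.t.
`(T, S_C)`, and every tuple `as` from `Ind(A)`:
`A ⊨ (T, S_C, q)(as)` iff `A ⊨ (T, ∅, q)(as)`. -/
theorem statement_10 (T : ELTBox) (Sc Sr : Set ℕ)
    (hfin : Sc.Finite ∧ Sr.Finite) (hsafe : ELSafe T Sc Sr)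
    (q : FO) (hq : IsUCQ q) (xs : List ℕ) (hfree : q.free ⊆ {x | x ∈ xs})
    (A : ABox) (hA : A.Fin)
    (hcons : consistentW (fun I => I.modelEL T) Sc Sr A)
    (as : List ℕ) (hlen : as.length = xs.length) (hind : ∀ a ∈ as, a ∈ A.ind) :
    certAns (fun I => I.modelEL T) Sc Sr A q xs as ↔
    certAns (fun I => I.modelEL T) ∅ ∅ A q xs as := by
  constructor
  · intro hclosed I hI hIA _
    obtain ⟨J, f, hJ, hJA, hJresp, hf, hnames⟩ := hsafe.exists_respects_isHom hcons hI hIA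
    obtain ⟨v, hv, hvq⟩ := hclosed J hJ hJA hJresp
    refine ⟨f ∘ v, fun p hp => ?_, hf.evalFO_of_isUCQ hq v hvq⟩
    obtain ⟨e, he⟩ := hIA.ind_isSome (hind p.2 (List.of_mem_zip hp).2)
    rw [he, Function.comp_apply, hnames p.2 _ e (hv p hp) he]
  · exact fun hopen I hI hIA _ => hopen I hI hIA ⟨fun _ hB => hB.elim, fun _ hr => hr.elim⟩

end DL
end

section
/- Let C, D be EL concepts and T an EL TBox with T ⊨ C ⊑ ∃r.D. Then at least one of the following holds: (1) there is a top-level conjunct ∃r.C' of C such that T ⊨ C' ⊑ D; (2) there is a concept ∃r.C' ∈ sub(T) such that T ⊨ C ⊑ ∃r.C' and T ⊨ C' ⊑ D. -/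
namespace DL

theorem EL.isTlc_refl (E : EL) : E.isTlc E := by
  cases E <;> simp [EL.isTlc]

theorem EL.isTlc_of_conj {F G E : EL} (h : (EL.conj F G).isTlc E) :
    F.isTlc E ∧ G.isTlc E := by
  induction E with
  | conj C D ihC ihD =>
    simp only [EL.isTlc] at h ⊢
    rcases h with h | h | h
    · cases h
      exact ⟨.inr (.inl F.isTlc_refl), .inr (.inr G.isTlc_refl)⟩
    · exact ⟨.inr (.inl (ihC h).1), .inr (.inl (ihC h).2)⟩
    · exact ⟨.inr (.inr (ihD h).1), .inr (.inr (ihD h).2)⟩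
  | _ => simp [EL.isTlc] at h

theorem Interp.semE_subset_of_isTlc (I : Interp) {E F : EL} (h : F.isTlc E) :
    I.semE E ⊆ I.semE F := by
  induction E with
  | conj C D ihC ihD =>
    simp only [EL.isTlc] at h
    rcases h with rfl | h | h
    · exact subset_rfl
    · exact fun _ hd => ihC h hd.1
    · exact fun _ hd => ihD h hd.2
  | _ =>
    simp only [EL.isTlc] at h
    rw [h]

theorem EL.mem_subs_self (E : EL) : E ∈ E.subs := by
  cases E <;> simp [EL.subs]

theorem EL.mem_subs_of_conj {F G E : EL} (h : EL.conj F G ∈ E.subs) :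
    F ∈ E.subs ∧ G ∈ E.subs := by
  induction E with
  | conj C D ihC ihD =>
    simp only [EL.subs, Set.mem_insert_iff, Set.mem_union] at h ⊢
    rcases h with h | h | h
    · cases h
      exact ⟨.inr (.inl F.mem_subs_self), .inr (.inr G.mem_subs_self)⟩
    · exact ⟨.inr (.inl (ihC h).1), .inr (.inl (ihC h).2)⟩
    · exact ⟨.inr (.inr (ihD h).1), .inr (.inr (ihD h).2)⟩
  | ex r C ih =>
    simp only [EL.subs, Set.mem_insert_iff, reduceCtorEq, false_or] at h ⊢
    exact ⟨.inr (ih h).1, .inr (ih h).2⟩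
  | _ => simp [EL.subs] at h

theorem mem_elSubsT_of_conj {T : ELTBox} {F G : EL} (h : EL.conj F G ∈ elSubsT T) :
    F ∈ elSubsT T ∧ G ∈ elSubsT T := by
  obtain ⟨p, hp, h | h⟩ := h
  · exact ⟨⟨p, hp, .inl (EL.mem_subs_of_conj h).1⟩, ⟨p, hp, .inl (EL.mem_subs_of_conj h).2⟩⟩
  · exact ⟨⟨p, hp, .inr (EL.mem_subs_of_conj h).1⟩, ⟨p, hp, .inr (EL.mem_subs_of_conj h).2⟩⟩

/-- The canonical model of an EL TBox: its elements are the EL concepts, and the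
`r`-successors of `E` are the concepts `F` such that `∃r.F` is a top-level conjunct of
`E`, or is a subconcept of the TBox that is implied by `E`. -/
def canonicalModel (T : ELTBox) : Interp where
  Dom := EL
  dne := ⟨.top⟩
  ind := fun _ => none
  ind_inj := by simp
  cInt := fun B => {E | elEnt T E (.atom B)}
  rInt := fun r => {p | (EL.ex r p.2).isTlc p.1 ∨
    (EL.ex r p.2 ∈ elSubsT T ∧ elEnt T p.1 (.ex r p.2))}

theorem canonicalModel_mem_of_isTlc (T : ELTBox) {E F : EL} (h : F.isTlc E) :
    E ∈ (canonicalModel T).semE F := by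
  induction F generalizing E with
  | atom B => exact fun I _ => I.semE_subset_of_isTlc h
  | top => exact Set.mem_univ _
  | conj F G ihF ihG =>
    exact ⟨ihF (EL.isTlc_of_conj h).1, ihG (EL.isTlc_of_conj h).2⟩
  | ex r F ih => exact ⟨F, .inl h, ih F.isTlc_refl⟩

theorem elEnt_of_canonicalModel_mem {T : ELTBox} {E F : EL}
    (h : E ∈ (canonicalModel T).semE F) : elEnt T E F := by
  induction F generalizing E with
  | atom B => exact h
  | top => exact fun _ _ => Set.subset_univ _
  | conj F G ihF ihG => exact fun I hI d hd => ⟨ihF h.1 I hI hd, ihG h.2 I hI hd⟩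
  | ex r F ih =>
    obtain ⟨E', hr, hE'⟩ := h
    have hEE' : elEnt T E (.ex r E') :=
      hr.elim (fun ht I _ => I.semE_subset_of_isTlc ht) fun hs => hs.2
    intro I hI d hd
    obtain ⟨e, hde, he⟩ := hEE' I hI hd
    exact ⟨e, hde, ih hE' I hI he⟩

theorem canonicalModel_mem_of_elEnt {T : ELTBox} {E F : EL} (hF : F ∈ elSubsT T)
    (h : elEnt T E F) : E ∈ (canonicalModel T).semE F := by
  induction F with
  | atom B => exact h
  | top => exact Set.mem_univ _
  | conj F G ihF ihG =>
    exact ⟨ihF (mem_elSubsT_of_conj hF).1 fun I hI _ hd => (h I hI hd).1,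
      ihG (mem_elSubsT_of_conj hF).2 fun I hI _ hd => (h I hI hd).2⟩
  | ex r F =>
    exact ⟨F, .inr ⟨hF, h⟩, canonicalModel_mem_of_isTlc T F.isTlc_refl⟩

theorem canonicalModel_modelEL (T : ELTBox) : (canonicalModel T).modelEL T :=
  fun p hp _ hE => canonicalModel_mem_of_elEnt ⟨p, hp, .inr p.2.mem_subs_self⟩
    fun I hI _ hd => hI p hp (elEnt_of_canonicalModel_mem hE I hI hd)

/-- If `T ⊨ C ⊑ ∃r.D` for EL concepts `C, D` and an EL TBox
`T`, then either some top-level conjunct `∃r.C'` of `C` satisfies `T ⊨ C' ⊑ D`,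
or some `∃r.C' ∈ sub(T)` satisfies `T ⊨ C ⊑ ∃r.C'` and `T ⊨ C' ⊑ D`. -/
theorem statement_12 (T : ELTBox) (C D : EL) (r : ℕ)
    (h : elEnt T C (.ex r D)) :
    (∃ C' : EL, EL.isTlc (.ex r C') C ∧ elEnt T C' D) ∨
    (∃ C' : EL, EL.ex r C' ∈ elSubsT T ∧ elEnt T C (.ex r C') ∧ elEnt T C' D) := by
  obtain ⟨C', hr, hC'⟩ := h (canonicalModel T) (canonicalModel_modelEL T)
    (canonicalModel_mem_of_isTlc T C.isTlc_refl)
  have hD := elEnt_of_canonicalModel_mem hC'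
  exact hr.imp (fun ht => ⟨C', ht, hD⟩) fun hs => ⟨C', hs.1, hs.2, hD⟩

end DL
end

section
/- Let T be an EL TBox and A a (possibly infinite) ABox. Then there exists an interpretation J such that: (1) J is a model of T and A; (2) for every model I of T and A, there is a homomorphism h from J to I with h(a) = a for all a ∈ Ind(A); (3) for all UCQs q(x⃗) and all tuples a⃗ from Ind(A): A ⊨ (T, ∅, q)(a⃗) iff J ⊨ q(a⃗). -/
namespace DL

/-- `h` is a homomorphism from `I` to `J`. -/
def IsHom (I J : Interp) (h : I.Dom → J.Dom) : Prop :=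
  (∀ B : ℕ, ∀ d, d ∈ I.cInt B → h d ∈ J.cInt B) ∧
  (∀ r : ℕ, ∀ d e, (d, e) ∈ I.rInt r → (h d, h e) ∈ J.rInt r)

/-- `h` preserves all individual names: the element named `a` in `I` is mapped
to the element named `a` in `J` (i.e. `h(a) = a` for all `a ∈ N_I ∩ Δ^I`). -/
def PreservesInd (I J : Interp) (h : I.Dom → J.Dom) : Prop :=
  ∀ (a : ℕ) (d : I.Dom), I.ind a = some d → J.ind a = some (h d)

/-- Elements of the universal model: the individual names, together with a fresh
`r`-successor intended to satisfy `C`, for every element, role `r` and concept `C`. -/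
inductive CanonElt : Type
  | base (a : ℕ)
  | succ (t : CanonElt) (r : ℕ) (C : EL)

/-- `Derives T A t C` : the element `t` of the universal model is forced to satisfy `C`. -/
inductive Derives (T : ELTBox) (A : ABox) : CanonElt → EL → Prop
  | asserted {B a : ℕ} : (B, a) ∈ A.ca → Derives T A (.base a) (.atom B)
  | top (t : CanonElt) : Derives T A t .top
  | conj {t : CanonElt} {C D : EL} :
      Derives T A t C → Derives T A t D → Derives T A t (.conj C D)
  | left {t : CanonElt} {C D : EL} : Derives T A t (.conj C D) → Derives T A t C
  | right {t : CanonElt} {C D : EL} : Derives T A t (.conj C D) → Derives T A t D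
  | exBase {r a b : ℕ} {C : EL} :
      (r, a, b) ∈ A.ra → Derives T A (.base b) C → Derives T A (.base a) (.ex r C)
  | exSucc {t : CanonElt} {r : ℕ} {C D : EL} :
      Derives T A t (.ex r C) → Derives T A (.succ t r C) D → Derives T A t (.ex r D)
  | witness {t : CanonElt} {r : ℕ} {C : EL} :
      Derives T A t (.ex r C) → Derives T A (.succ t r C) C
  | incl {t : CanonElt} {C D : EL} : (C, D) ∈ T → Derives T A t C → Derives T A t D

/-- Role edges of the universal model. -/
inductive CanonEdge (T : ELTBox) (A : ABox) (r : ℕ) : CanonElt → CanonElt → Prop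
  | base {a b : ℕ} : (r, a, b) ∈ A.ra → CanonEdge T A r (.base a) (.base b)
  | succ {t : CanonElt} {C : EL} :
      Derives T A t (.ex r C) → CanonEdge T A r t (.succ t r C)

/-- The universal model of an EL TBox and an ABox. -/
def canonModel (T : ELTBox) (A : ABox) : Interp where
  Dom := CanonElt
  dne := ⟨.base 0⟩
  ind a := some (.base a)
  ind_inj a b d ha hb := by
    have h := ha.trans hb.symm
    simpa using h
  cInt B := {t | Derives T A t (.atom B)}
  rInt r := {p | CanonEdge T A r p.1 p.2}

theorem mem_semE_canonModel (T : ELTBox) (A : ABox) (C : EL) (t : CanonElt) :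
    t ∈ (canonModel T A).semE C ↔ Derives T A t C := by
  induction C generalizing t with
  | atom B => exact Iff.rfl
  | top => exact ⟨fun _ => .top t, fun _ => trivial⟩
  | conj C D ihC ihD =>
    constructor
    · rintro ⟨hC, hD⟩
      exact .conj ((ihC t).1 hC) ((ihD t).1 hD)
    · intro h
      exact ⟨(ihC t).2 h.left, (ihD t).2 h.right⟩
  | ex r C ih =>
    constructor
    · rintro ⟨e, hedge, he⟩
      have he' := (ih e).1 he
      change CanonEdge T A r t e at hedge
      cases hedge with
      | base hab => exact .exBase hab he'
      | succ ht => exact .exSucc ht he'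
    · intro h
      exact ⟨.succ t r C, CanonEdge.succ h, (ih _).2 h.witness⟩

theorem canonModel_modelEL (T : ELTBox) (A : ABox) : (canonModel T A).modelEL T := by
  intro p hp t ht
  exact (mem_semE_canonModel T A p.2 t).2
    (.incl hp ((mem_semE_canonModel T A p.1 t).1 ht))

theorem canonModel_modelA (T : ELTBox) (A : ABox) : (canonModel T A).modelA A :=
  ⟨fun p hp => ⟨.base p.2, rfl, Derives.asserted hp⟩,
    fun t ht => ⟨.base t.2.1, .base t.2.2, rfl, rfl, CanonEdge.base ht⟩⟩

open Classical in
/-- The map from the universal model to `I` choosing a witness in `I` for every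
existential restriction satisfied there. -/
noncomputable def canonMap (I : Interp) : CanonElt → I.Dom
  | .base a => (I.ind a).getD I.dne.some
  | .succ t r C =>
    if h : ∃ e, (canonMap I t, e) ∈ I.rInt r ∧ e ∈ I.semE C then h.choose else I.dne.some

theorem canonMap_base {I : Interp} {a : ℕ} {d : I.Dom} (h : I.ind a = some d) :
    canonMap I (.base a) = d := by
  simp [canonMap, h]

theorem canonMap_succ {I : Interp} {t : CanonElt} {r : ℕ} {C : EL}
    (h : canonMap I t ∈ I.semE (.ex r C)) :
    (canonMap I t, canonMap I (.succ t r C)) ∈ I.rInt r ∧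
      canonMap I (.succ t r C) ∈ I.semE C := by
  have h' : ∃ e, (canonMap I t, e) ∈ I.rInt r ∧ e ∈ I.semE C := h
  rw [canonMap, dif_pos h']
  exact h'.choose_spec

theorem canonMap_base_edge {A : ABox} {I : Interp} (hA : I.modelA A) {r a b : ℕ}
    (h : (r, a, b) ∈ A.ra) :
    (canonMap I (.base a), canonMap I (.base b)) ∈ I.rInt r := by
  obtain ⟨d, e, hd, he, hde⟩ := hA.2 _ h
  rwa [canonMap_base hd, canonMap_base he]

theorem canonMap_mem_semE {T : ELTBox} {A : ABox} {I : Interp} (hT : I.modelEL T)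
    (hA : I.modelA A) {t : CanonElt} {C : EL} (h : Derives T A t C) :
    canonMap I t ∈ I.semE C := by
  induction h with
  | asserted h =>
    obtain ⟨d, hd, hdB⟩ := hA.1 _ h
    rw [canonMap_base hd]
    exact hdB
  | top t => trivial
  | conj _ _ ihC ihD => exact ⟨ihC, ihD⟩
  | left _ ih => exact ih.1
  | right _ ih => exact ih.2
  | exBase hab _ ih => exact ⟨_, canonMap_base_edge hA hab, ih⟩
  | exSucc _ _ ih ihD => exact ⟨_, (canonMap_succ ih).1, ihD⟩
  | witness _ ih => exact (canonMap_succ ih).2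
  | incl hCD _ ih => exact hT _ hCD ih

theorem isHom_canonMap {T : ELTBox} {A : ABox} {I : Interp} (hT : I.modelEL T)
    (hA : I.modelA A) : IsHom (canonModel T A) I (canonMap I) := by
  refine ⟨fun B d hd => canonMap_mem_semE hT hA (C := .atom B) hd, fun r d e hde => ?_⟩
  change CanonEdge T A r d e at hde
  cases hde with
  | base hab => exact canonMap_base_edge hA hab
  | succ ht => exact (canonMap_succ (canonMap_mem_semE hT hA ht)).1

theorem Interp.modelA.exists_ind {I : Interp} {A : ABox} (hA : I.modelA A) {a : ℕ}
    (ha : a ∈ A.ind) : ∃ d, I.ind a = some d := by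
  rcases ha with ⟨p, hp, rfl⟩ | ⟨t, ht, rfl | rfl⟩
  · obtain ⟨d, hd, _⟩ := hA.1 p hp
    exact ⟨d, hd⟩
  · obtain ⟨d, _, hd, _⟩ := hA.2 t ht
    exact ⟨d, hd⟩
  · obtain ⟨_, e, _, he, _⟩ := hA.2 t ht
    exact ⟨e, he⟩

section Preservation

variable {I J : Interp} {h : I.Dom → J.Dom} {q : FO}

theorem IsHom.evalFO_conjAtoms (hh : IsHom I J h) (hq : IsConjAtoms q) (v : ℕ → I.Dom)
    (hv : I.evalFO v q) : J.evalFO (h ∘ v) q := by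
  induction hq with
  | capp B x => exact hh.1 B _ hv
  | rapp r x y => exact hh.2 r _ _ hv
  | conj _ _ ih₁ ih₂ => exact ⟨ih₁ hv.1, ih₂ hv.2⟩

theorem IsHom.evalFO_cq (hh : IsHom I J h) (hq : IsCQ q) (v : ℕ → I.Dom)
    (hv : I.evalFO v q) : J.evalFO (h ∘ v) q := by
  induction hq generalizing v with
  | base hφ => exact hh.evalFO_conjAtoms hφ v hv
  | ex x _ ih =>
    obtain ⟨d, hd⟩ := hv
    refine ⟨h d, ?_⟩
    rw [← Function.comp_update]
    exact ih _ hd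

/-- Homomorphisms preserve unions of conjunctive queries. -/
theorem IsHom.evalFO_ucq (hh : IsHom I J h) (hq : IsUCQ q) (v : ℕ → I.Dom)
    (hv : I.evalFO v q) : J.evalFO (h ∘ v) q := by
  induction hq with
  | base hφ => exact hh.evalFO_cq hφ v hv
  | disj _ _ ih₁ ih₂ => exact hv.imp ih₁ ih₂

end Preservation

/-- For every EL TBox `T` and every (possibly infinite) ABox
`A` there is an interpretation `J` such that:
1. `J` is a model of `T` and `A`;
2. for every model `I` of `T` and `A` there is a homomorphism from `J` to `I`
   preserving `Ind(A)`;
3. for all UCQs `q(xs)` and all tuples `as` from `Ind(A)`: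
   `A ⊨ (T, ∅, q)(as)` iff `J ⊨ q(as)`. -/
theorem statement_13 (T : ELTBox) (A : ABox) :
    ∃ J : Interp,
      (J.modelEL T ∧ J.modelA A) ∧
      (∀ I : Interp, I.modelEL T → I.modelA A →
        ∃ h : J.Dom → I.Dom, IsHom J I h ∧
          ∀ a ∈ A.ind, ∀ (d : J.Dom) (d' : I.Dom),
            J.ind a = some d → I.ind a = some d' → h d = d') ∧
      (∀ q : FO, IsUCQ q → ∀ xs : List ℕ, q.free ⊆ {x | x ∈ xs} →
        ∀ as : List ℕ, as.length = xs.length → (∀ a ∈ as, a ∈ A.ind) →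
          (certAns (fun I => I.modelEL T) ∅ ∅ A q xs as ↔ J.sat q xs as)) := by
  refine ⟨canonModel T A, ⟨canonModel_modelEL T A, canonModel_modelA T A⟩, ?_, ?_⟩
  · intro I hT hA
    refine ⟨canonMap I, isHom_canonMap hT hA, fun a _ d d' hd hd' => ?_⟩
    cases hd
    exact canonMap_base hd'
  · intro q hq xs _ as _ has
    constructor
    · intro hcert
      exact hcert _ (canonModel_modelEL T A) (canonModel_modelA T A)
        ⟨fun _ hB => hB.elim, fun _ hr => hr.elim⟩
    · rintro ⟨v, hv, hqv⟩ I hT hA -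
      refine ⟨canonMap I ∘ v, fun p hp => ?_, (isHom_canonMap hT hA).evalFO_ucq hq v hqv⟩
      obtain ⟨d, hd⟩ := hA.exists_ind (has p.2 (List.of_mem_zip hp).2)
      have hvp : CanonElt.base p.2 = v p.1 := Option.some.inj (hv p hp)
      have hvd : canonMap I (v p.1) = d := hvp ▸ canonMap_base hd
      exact hd.trans (congrArg some hvd.symm)

end DL
end

section
/- (EL interpolation) Let T₁, T₂ be EL TBoxes and D₁, D₂ EL concepts with T₁ ∪ T₂ ⊨ D₁ ⊑ D₂, and let Σ = sig(T₁, D₁) ∩ sig(T₂, D₂). Then there exists an EL concept F with sig(F) ⊆ Σ such that T₁ ∪ T₂ ⊨ D₁ ⊑ F and T₁ ∪ T₂ ⊨ F ⊑ D₂. -/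
namespace DL

/-- A calculus for `T ⊨ C ⊑ D` in which transitivity is only used through inclusions of `T`. -/
inductive Derives_s15 (T : ELTBox) : EL → EL → Prop
  | refl (C : EL) : Derives_s15 T C C
  | top (C : EL) : Derives_s15 T C .top
  | conjLeft {C E : EL} (D : EL) : Derives_s15 T C E → Derives_s15 T (.conj C D) E
  | conjRight {D E : EL} (C : EL) : Derives_s15 T D E → Derives_s15 T (.conj C D) E
  | conj {C D E : EL} : Derives_s15 T C D → Derives_s15 T C E → Derives_s15 T C (.conj D E)
  | ex {C D : EL} (r : ℕ) : Derives_s15 T C D → Derives_s15 T (.ex r C) (.ex r D)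
  | incl {C E : EL} (p : EL × EL) :
      p ∈ T → Derives_s15 T C p.1 → Derives_s15 T p.2 E → Derives_s15 T C E

theorem Derives_s15.elEnt {T : ELTBox} {C D : EL} (h : Derives_s15 T C D) : elEnt T C D := by
  intro I hI
  induction h with
  | refl => exact subset_rfl
  | top => exact Set.subset_univ _
  | conjLeft _ _ ih => exact Set.inter_subset_left.trans ih
  | conjRight _ _ ih => exact Set.inter_subset_right.trans ih
  | conj _ _ ihD ihE => exact Set.subset_inter ihD ihE
  | ex _ _ ih => exact fun _ ⟨e, hr, he⟩ => ⟨e, hr, ih he⟩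
  | incl p hp _ _ ihC ihE => exact (ihC.trans (hI p hp)).trans ihE

/-- `Successor T r C D` states that `∃r.D` is a top-level conjunct of `C` or of the
right-hand side of an inclusion of `T` that applies to `C`, possibly after further inclusions. -/
inductive Successor (T : ELTBox) (r : ℕ) : EL → EL → Prop
  | ex (D : EL) : Successor T r (.ex r D) D
  | conjLeft {C E : EL} (D : EL) : Successor T r C E → Successor T r (.conj C D) E
  | conjRight {D E : EL} (C : EL) : Successor T r D E → Successor T r (.conj C D) E
  | incl {C E : EL} (p : EL × EL) :
      p ∈ T → Derives_s15 T C p.1 → Successor T r p.2 E → Successor T r C E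

theorem Successor.derives_ex {T : ELTBox} {r : ℕ} {C D E : EL} (h : Successor T r C D)
    (hE : Derives_s15 T D E) : Derives_s15 T C (.ex r E) := by
  induction h with
  | ex => exact .ex r hE
  | conjLeft _ _ ih => exact .conjLeft _ (ih hE)
  | conjRight _ _ ih => exact .conjRight _ (ih hE)
  | incl p hp hC _ ih => exact .incl p hp hC (ih hE)

theorem Derives_s15.of_conj {T : ELTBox} {C D E : EL} (h : Derives_s15 T C (.conj D E)) :
    Derives_s15 T C D ∧ Derives_s15 T C E := by
  generalize hX : EL.conj D E = X at h
  induction h with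
  | refl => subst hX; exact ⟨.conjLeft _ (.refl _), .conjRight _ (.refl _)⟩
  | top | ex => cases hX
  | conjLeft _ _ ih => exact ⟨.conjLeft _ (ih hX).1, .conjLeft _ (ih hX).2⟩
  | conjRight _ _ ih => exact ⟨.conjRight _ (ih hX).1, .conjRight _ (ih hX).2⟩
  | conj hD hE => cases hX; exact ⟨hD, hE⟩
  | incl p hp hC _ _ ih => exact ⟨.incl p hp hC (ih hX).1, .incl p hp hC (ih hX).2⟩

theorem Derives_s15.exists_successor {T : ELTBox} {r : ℕ} {C E : EL} (h : Derives_s15 T C (.ex r E)) :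
    ∃ D, Successor T r C D ∧ Derives_s15 T D E := by
  generalize hX : EL.ex r E = X at h
  induction h with
  | refl => subst hX; exact ⟨E, .ex E, .refl E⟩
  | top | conj => cases hX
  | conjLeft _ _ ih =>
    obtain ⟨D, hs, hD⟩ := ih hX
    exact ⟨D, .conjLeft _ hs, hD⟩
  | conjRight _ _ ih =>
    obtain ⟨D, hs, hD⟩ := ih hX
    exact ⟨D, .conjRight _ hs, hD⟩
  | ex _ hD => cases hX; exact ⟨_, .ex _, hD⟩
  | incl p hp hC _ _ ih =>
    obtain ⟨D, hs, hD⟩ := ih hX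
    exact ⟨D, .incl p hp hC hs, hD⟩

/-- The canonical model of `T`, whose elements are all EL concepts. -/
def canonical (T : ELTBox) : Interp where
  Dom := EL
  dne := ⟨.top⟩
  ind _ := none
  ind_inj _ _ _ h := by cases h
  cInt B := {C | Derives_s15 T C (.atom B)}
  rInt r := {p | Successor T r p.1 p.2}

theorem mem_semE_canonical (T : ELTBox) (C E : EL) :
    C ∈ (canonical T).semE E ↔ Derives_s15 T C E := by
  induction E generalizing C with
  | atom => exact Iff.rfl
  | top => exact iff_of_true trivial (.top C)
  | conj D E ihD ihE =>
    exact (and_congr (ihD C) (ihE C)).trans ⟨fun h => .conj h.1 h.2, Derives_s15.of_conj⟩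
  | ex r E ih =>
    constructor
    · rintro ⟨D, hs, hD⟩
      exact Successor.derives_ex hs ((ih D).1 hD)
    · intro h
      obtain ⟨D, hs, hD⟩ := h.exists_successor
      exact ⟨D, hs, (ih D).2 hD⟩

theorem modelEL_canonical (T : ELTBox) : (canonical T).modelEL T := fun p hp C hC =>
  (mem_semE_canonical T C p.2).2 (.incl p hp ((mem_semE_canonical T C p.1).1 hC) (.refl _))

theorem derives_of_elEnt {T : ELTBox} {C D : EL} (h : elEnt T C D) : Derives_s15 T C D :=
  (mem_semE_canonical T C D).1
    (h _ (modelEL_canonical T) ((mem_semE_canonical T C C).2 (.refl C)))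

theorem Derives_s15.exists_interpolant {T₁ T₂ : ELTBox} {C E : EL} {c₁ c₂ r₁ r₂ : Set ℕ}
    (h : Derives_s15 (T₁ ++ T₂) C E)
    (hTc₁ : elTSigC T₁ ⊆ c₁) (hTr₁ : elTSigR T₁ ⊆ r₁)
    (hTc₂ : elTSigC T₂ ⊆ c₂) (hTr₂ : elTSigR T₂ ⊆ r₂)
    (hCc : C.sigC ⊆ c₁) (hCr : C.sigR ⊆ r₁) (hEc : E.sigC ⊆ c₂) (hEr : E.sigR ⊆ r₂) :
    ∃ F : EL, F.sigC ⊆ c₁ ∩ c₂ ∧ F.sigR ⊆ r₁ ∩ r₂ ∧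
      DL.elEnt (T₁ ++ T₂) C F ∧ DL.elEnt (T₁ ++ T₂) F E := by
  induction h with
  | refl C =>
    exact ⟨C, Set.subset_inter hCc hEc, Set.subset_inter hCr hEr,
      (Derives_s15.refl C).elEnt, (Derives_s15.refl C).elEnt⟩
  | top C =>
    exact ⟨.top, Set.empty_subset _, Set.empty_subset _,
      (Derives_s15.top C).elEnt, (Derives_s15.top _).elEnt⟩
  | conjLeft D _ ih =>
    obtain ⟨F, hFc, hFr, hCF, hFE⟩ :=
      ih (Set.subset_union_left.trans hCc) (Set.subset_union_left.trans hCr) hEc hEr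
    exact ⟨F, hFc, hFr, fun I hI => Set.inter_subset_left.trans (hCF I hI), hFE⟩
  | conjRight D _ ih =>
    obtain ⟨F, hFc, hFr, hCF, hFE⟩ :=
      ih (Set.subset_union_right.trans hCc) (Set.subset_union_right.trans hCr) hEc hEr
    exact ⟨F, hFc, hFr, fun I hI => Set.inter_subset_right.trans (hCF I hI), hFE⟩
  | conj _ _ ihD ihE =>
    obtain ⟨F, hFc, hFr, hCF, hFD⟩ :=
      ihD hCc hCr (Set.subset_union_left.trans hEc) (Set.subset_union_left.trans hEr)
    obtain ⟨G, hGc, hGr, hCG, hGE⟩ :=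
      ihE hCc hCr (Set.subset_union_right.trans hEc) (Set.subset_union_right.trans hEr)
    exact ⟨.conj F G, Set.union_subset hFc hGc, Set.union_subset hFr hGr,
      fun I hI => Set.subset_inter (hCF I hI) (hCG I hI),
      fun I hI => Set.inter_subset_inter (hFD I hI) (hGE I hI)⟩
  | ex r _ ih =>
    obtain ⟨F, hFc, hFr, hCF, hFE⟩ :=
      ih hCc ((Set.subset_insert _ _).trans hCr) hEc ((Set.subset_insert _ _).trans hEr)
    exact ⟨.ex r F, hFc,
      Set.insert_subset ⟨hCr (Set.mem_insert _ _), hEr (Set.mem_insert _ _)⟩ hFr,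
      fun I hI _ ⟨e, hr, he⟩ => ⟨e, hr, hCF I hI he⟩,
      fun I hI _ ⟨e, hr, he⟩ => ⟨e, hr, hFE I hI he⟩⟩
  | incl p hp hC hE ihC ihE =>
    rcases List.mem_append.1 hp with hp' | hp'
    · obtain ⟨F, hFc, hFr, hpF, hFE⟩ :=
        ihE (fun B hB => hTc₁ ⟨p, hp', .inr hB⟩) (fun s hs => hTr₁ ⟨p, hp', .inr hs⟩) hEc hEr
      exact ⟨F, hFc, hFr,
        fun I hI => ((hC.elEnt I hI).trans (hI p hp)).trans (hpF I hI), hFE⟩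
    · obtain ⟨F, hFc, hFr, hCF, hFp⟩ :=
        ihC hCc hCr (fun B hB => hTc₂ ⟨p, hp', .inl hB⟩) (fun s hs => hTr₂ ⟨p, hp', .inl hs⟩)
      exact ⟨F, hFc, hFr, hCF,
        fun I hI => ((hFp I hI).trans (hI p hp)).trans (hE.elEnt I hI)⟩

/-- **EL interpolation.**  Let `T₁, T₂` be EL TBoxes and
`D₁, D₂` EL concepts with `T₁ ∪ T₂ ⊨ D₁ ⊑ D₂`, and let
`Σ = sig(T₁, D₁) ∩ sig(T₂, D₂)`.  Then there is an EL concept `F` with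
`sig(F) ⊆ Σ` such that `T₁ ∪ T₂ ⊨ D₁ ⊑ F` and `T₁ ∪ T₂ ⊨ F ⊑ D₂`. -/
theorem statement_15 (T₁ T₂ : ELTBox) (D₁ D₂ : EL)
    (h : elEnt (T₁ ++ T₂) D₁ D₂) :
    ∃ F : EL,
      F.sigC ⊆ (elTSigC T₁ ∪ D₁.sigC) ∩ (elTSigC T₂ ∪ D₂.sigC) ∧
      F.sigR ⊆ (elTSigR T₁ ∪ D₁.sigR) ∩ (elTSigR T₂ ∪ D₂.sigR) ∧
      elEnt (T₁ ++ T₂) D₁ F ∧ elEnt (T₁ ++ T₂) F D₂ := by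
  exact (derives_of_elEnt h).exists_interpolant
    Set.subset_union_left Set.subset_union_left Set.subset_union_left Set.subset_union_left
    Set.subset_union_right Set.subset_union_right Set.subset_union_right Set.subset_union_right

end DL
end

section
/- Let T be a DL-Lite_R TBox containing no role inclusion s ⊑ r with sig(s) ⊄ Σ and sig(r) ⊆ Σ, where Σ is a signature. Then a Σ-ABox A is consistent w.r.t. (T, Σ) iff: (1) A has a T-decoration f whose image is a Σ-realizable T-typing, and (2) whenever s(a,b) ∈ A and s ⊑ r ∈ R_Σ, then r(a,b) ∈ A. -/
namespace DL

/-- DL-Lite basic concepts: concept names and unqualified existential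
restrictions `∃ρ` over (possibly inverse) roles. -/
inductive Basic : Type
  | atom (B : ℕ)
  | ex (ρ : Role)
  deriving DecidableEq

/-- Semantics of basic concepts. -/
def Interp.semB (I : Interp) : Basic → Set I.Dom
  | .atom B => I.cInt B
  | .ex ρ => {d | ∃ e, (d, e) ∈ I.rI ρ}

/-- DL-Lite_R axioms: positive and negative concept inclusions between
basic concepts, and role inclusions. -/
inductive LiteAx : Type
  | pos (B₁ B₂ : Basic)
  | npos (B₁ B₂ : Basic)
  | ri (ρ σ : Role)

/-- A DL-Lite_R TBox is a finite list of axioms. -/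
abbrev LiteTBox := List LiteAx

/-- `I` is a model of the DL-Lite_R TBox `T`. -/
def Interp.modelLite (I : Interp) (T : LiteTBox) : Prop :=
  (∀ B₁ B₂ : Basic, LiteAx.pos B₁ B₂ ∈ T → I.semB B₁ ⊆ I.semB B₂) ∧
  (∀ B₁ B₂ : Basic, LiteAx.npos B₁ B₂ ∈ T → I.semB B₁ ∩ I.semB B₂ = ∅) ∧
  (∀ ρ σ : Role, LiteAx.ri ρ σ ∈ T → I.rI ρ ⊆ I.rI σ)

/-- `T ⊨ B₁ ⊑ B₂`. -/
def liteEntPos (T : LiteTBox) (B₁ B₂ : Basic) : Prop :=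
  ∀ I : Interp, I.modelLite T → I.semB B₁ ⊆ I.semB B₂

/-- `T ⊨ B₁ ⊑ ¬B₂`. -/
def liteEntNeg (T : LiteTBox) (B₁ B₂ : Basic) : Prop :=
  ∀ I : Interp, I.modelLite T → I.semB B₁ ∩ I.semB B₂ = ∅

/-- `T ⊨ ρ ⊑ σ`. -/
def liteEntRI (T : LiteTBox) (ρ σ : Role) : Prop :=
  ∀ I : Interp, I.modelLite T → I.rI ρ ⊆ I.rI σ

/-- `B` is satisfiable w.r.t. `T`. -/
def liteSat (T : LiteTBox) (B : Basic) : Prop :=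
  ∃ I : Interp, I.modelLite T ∧ (I.semB B).Nonempty

/-- Concept names occurring in a basic concept. -/
def Basic.sigC : Basic → Set ℕ
  | .atom B => {B}
  | .ex _ => ∅

/-- Role names occurring in a basic concept. -/
def Basic.sigR : Basic → Set ℕ
  | .atom _ => ∅
  | .ex ρ => {ρ.name}

/-- Safeness of a DL-Lite_R TBox with closed predicates `(T, S_C)` where
`S_C` consists of the concept names `Sc` and the role names `Sr`. -/
def LiteSafe (T : LiteTBox) (Sc Sr : Set ℕ) : Prop :=
  ¬ ∃ (B₁ B₂ : Basic) (ρ : Role),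
      liteSat T B₁ ∧
      liteEntPos T B₁ (.ex ρ) ∧ liteEntPos T (.ex ρ.flip) B₂ ∧
      (∀ ρ' : Role, liteEntRI T ρ' ρ → B₁ ≠ .ex ρ') ∧
      (B₂.sigC ⊆ Sc ∧ B₂.sigR ⊆ Sr) ∧
      (∀ ρ' : Role, liteEntPos T B₁ (.ex ρ') → liteEntRI T ρ' ρ → ρ'.name ∉ Sr)

/-- Concept names occurring in a DL-Lite axiom. -/
def LiteAx.sigC : LiteAx → Set ℕ
  | .pos B₁ B₂ => B₁.sigC ∪ B₂.sigC
  | .npos B₁ B₂ => B₁.sigC ∪ B₂.sigC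
  | .ri _ _ => ∅

/-- Role names occurring in a DL-Lite axiom. -/
def LiteAx.sigR : LiteAx → Set ℕ
  | .pos B₁ B₂ => B₁.sigR ∪ B₂.sigR
  | .npos B₁ B₂ => B₁.sigR ∪ B₂.sigR
  | .ri ρ σ => {ρ.name, σ.name}

/-- Concept names occurring in a DL-Lite_R TBox. -/
def liteTSigC (T : LiteTBox) : Set ℕ := {B | ∃ ax ∈ T, B ∈ LiteAx.sigC ax}

/-- Role names occurring in a DL-Lite_R TBox. -/
def liteTSigR (T : LiteTBox) : Set ℕ := {r | ∃ ax ∈ T, r ∈ LiteAx.sigR ax}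

/-- `con(T)`: the concept names of `T` together with `∃r`, `∃r⁻` for the role
names `r` of `T`. -/
def conT (T : LiteTBox) : Set Basic :=
  {B | ∃ P ∈ liteTSigC T, B = .atom P} ∪
  {B | ∃ r ∈ liteTSigR T, B = .ex (.nm r) ∨ B = .ex (.inv r)}

/-- A `T`-type: a subset of `con(T)` closed under positive entailment and
consistent w.r.t. negative entailment. -/
def IsTType (T : LiteTBox) (t : Set Basic) : Prop :=
  t ⊆ conT T ∧
  (∀ B₁ ∈ t, ∀ B₂ ∈ conT T, liteEntPos T B₁ B₂ → B₂ ∈ t) ∧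
  (∀ B₁ ∈ t, ∀ B₂ ∈ conT T, liteEntNeg T B₁ B₂ → B₂ ∉ t)

/-- `sig(B) ⊆ S` for a basic concept, where `S = (Sc, Sr)`. -/
def sigIn (Sc Sr : Set ℕ) (B : Basic) : Prop := B.sigC ⊆ Sc ∧ B.sigR ⊆ Sr

/-- A path `t, r₁, …, rₙ` in the `T`-typing `𝒯` (the roles `rs` are nonempty,
their existential restrictions belong to `con(T)` and use no predicate of the
signature, `∃r₁ ∈ t`, and consecutive roles are compatibly entailed). -/
def IsPathIn (T : LiteTBox) (Sr : Set ℕ) (TT : Set (Set Basic))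
    (t : Set Basic) (rs : List Role) : Prop :=
  t ∈ TT ∧ rs ≠ [] ∧
  (∀ ρ ∈ rs, Basic.ex ρ ∈ conT T ∧ ρ.name ∉ Sr) ∧
  (∀ ρ : Role, rs.head? = some ρ → Basic.ex ρ ∈ t) ∧
  (∀ i : ℕ, (h : i + 1 < rs.length) →
    liteEntPos T (.ex (rs[i]'(by omega)).flip) (.ex (rs[i + 1]'h)) ∧
    (rs[i]'(by omega)).flip ≠ rs[i + 1]'h)

/-- The path with roles `rs` is `S`-participating. -/
def Participating (T : LiteTBox) (Sc Sr : Set ℕ) (rs : List Role) : Prop :=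
  (∀ i : ℕ, (h : i + 1 < rs.length) →
    ¬ ∃ B ∈ conT T, sigIn Sc Sr B ∧ liteEntPos T (.ex (rs[i]'(by omega)).flip) B) ∧
  (∀ ρ : Role, rs.getLast? = some ρ →
    ∃ B ∈ conT T, sigIn Sc Sr B ∧ liteEntPos T (.ex ρ.flip) B)

/-- The `T`-typing `TT` is `S`-realizable. -/
def Realizable (T : LiteTBox) (Sc Sr : Set ℕ) (TT : Set (Set Basic)) : Prop :=
  ∀ (t : Set Basic) (rs : List Role),
    IsPathIn T Sr TT t rs → Participating T Sc Sr rs →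
    ∀ ρ : Role, rs.getLast? = some ρ →
      ∃ u ∈ TT, {B | B ∈ conT T ∧ liteEntPos T (.ex ρ.flip) B} ⊆ u

/-- `B` holds at `a` in the interpretation `I_A` corresponding to the ABox. -/
def ABox.holdsB (A : ABox) : Basic → ℕ → Prop
  | .atom P, a => (P, a) ∈ A.ca
  | .ex (.nm r), a => ∃ b, (r, a, b) ∈ A.ra
  | .ex (.inv r), a => ∃ b, (r, b, a) ∈ A.ra

/-- `t^a_A`: the basic concepts of `con(T)` satisfied at `a` in `I_A`. -/
def tpA (T : LiteTBox) (A : ABox) (a : ℕ) : Set Basic :=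
  {B | B ∈ conT T ∧ A.holdsB B a}

/-- A `T`-decoration of `A`: an assignment of `T`-types to the individuals of
`A` agreeing with `t^a_A` on all basic concepts over the signature `S`. -/
def Decoration (T : LiteTBox) (Sc Sr : Set ℕ) (A : ABox) (f : ℕ → Set Basic) : Prop :=
  ∀ a ∈ A.ind, IsTType T (f a) ∧
    ∀ B : Basic, sigIn Sc Sr B → (B ∈ f a ↔ B ∈ tpA T A a)

/-- The role assertion `ρ(a,b)` is in `A` (where `ρ⁻(a,b) ∈ A` stands for
`ρ(b,a) ∈ A`). -/
def ABox.holdsR (A : ABox) : Role → ℕ → ℕ → Prop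
  | .nm r, a, b => (r, a, b) ∈ A.ra
  | .inv r, a, b => (r, b, a) ∈ A.ra

@[simp] theorem Role.flip_flip (ρ : Role) : ρ.flip.flip = ρ := by cases ρ <;> rfl

@[simp] theorem Role.name_flip (ρ : Role) : ρ.flip.name = ρ.name := by cases ρ <;> rfl

theorem Interp.mem_rI_flip (I : Interp) (ρ : Role) (d e : I.Dom) :
    (d, e) ∈ I.rI ρ.flip ↔ (e, d) ∈ I.rI ρ := by
  cases ρ <;> rfl

theorem ABox.holdsB_ex (A : ABox) (ρ : Role) (a : ℕ) :
    A.holdsB (.ex ρ) a ↔ ∃ b, A.holdsR ρ a b := by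
  cases ρ <;> rfl

theorem ABox.mem_ind_of_holdsR {A : ABox} {ρ : Role} {a b : ℕ} (h : A.holdsR ρ a b) :
    a ∈ A.ind ∧ b ∈ A.ind := by
  cases ρ with
  | nm r => exact ⟨.inr ⟨_, h, .inl rfl⟩, .inr ⟨_, h, .inr rfl⟩⟩
  | inv r => exact ⟨.inr ⟨_, h, .inr rfl⟩, .inr ⟨_, h, .inl rfl⟩⟩

theorem ABox.mem_ind_of_holdsB {A : ABox} {B : Basic} {a : ℕ} (h : A.holdsB B a) :
    a ∈ A.ind := by
  cases B with
  | atom P => exact .inl ⟨_, h, rfl⟩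
  | ex ρ =>
    obtain ⟨b, hb⟩ := (A.holdsB_ex ρ a).1 h
    exact (ABox.mem_ind_of_holdsR hb).1

theorem Interp.modelA.ind_of_mem {I : Interp} {A : ABox} (h : I.modelA A) {a : ℕ}
    (ha : a ∈ A.ind) : ∃ d, I.ind a = some d := by
  rcases ha with ⟨p, hp, rfl⟩ | ⟨t, ht, rfl | rfl⟩
  · obtain ⟨d, hd, -⟩ := h.1 p hp
    exact ⟨d, hd⟩
  · obtain ⟨d, e, hd, -, -⟩ := h.2 t ht
    exact ⟨d, hd⟩
  · obtain ⟨d, e, -, he, -⟩ := h.2 t ht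
    exact ⟨e, he⟩

theorem sigIn_atom {Sc Sr : Set ℕ} {P : ℕ} : sigIn Sc Sr (.atom P) ↔ P ∈ Sc := by
  simp [sigIn, Basic.sigC, Basic.sigR]

theorem sigIn_ex {Sc Sr : Set ℕ} {ρ : Role} : sigIn Sc Sr (.ex ρ) ↔ ρ.name ∈ Sr := by
  simp [sigIn, Basic.sigC, Basic.sigR]

theorem Interp.respects.mem_rI {I : Interp} {A : ABox} {Sc Sr : Set ℕ}
    (h : I.respects A Sc Sr) {ρ : Role} (hρ : ρ.name ∈ Sr) (d e : I.Dom) :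
    (d, e) ∈ I.rI ρ ↔
      ∃ a b, I.ind a = some d ∧ I.ind b = some e ∧ A.holdsR ρ a b := by
  cases ρ with
  | nm r => exact h.2 r hρ d e
  | inv r =>
    refine (h.2 r hρ e d).trans ⟨?_, ?_⟩ <;>
    · rintro ⟨a, b, ha, hb, hab⟩
      exact ⟨b, a, hb, ha, hab⟩

theorem Interp.respects.mem_semB {I : Interp} {A : ABox} {Sc Sr : Set ℕ}
    (h : I.respects A Sc Sr) (hA : I.modelA A) {B : Basic} (hB : sigIn Sc Sr B) (d : I.Dom) :
    d ∈ I.semB B ↔ ∃ a, I.ind a = some d ∧ A.holdsB B a := by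
  cases B with
  | atom P => exact h.1 P (sigIn_atom.1 hB) d
  | ex ρ =>
    constructor
    · rintro ⟨e, he⟩
      obtain ⟨a, b, ha, -, hab⟩ := (h.mem_rI (sigIn_ex.1 hB) d e).1 he
      exact ⟨a, ha, (A.holdsB_ex ρ a).2 ⟨b, hab⟩⟩
    · rintro ⟨a, ha, hab⟩
      obtain ⟨b, hab⟩ := (A.holdsB_ex ρ a).1 hab
      obtain ⟨e, he⟩ := hA.ind_of_mem (ABox.mem_ind_of_holdsR hab).2
      exact ⟨e, (h.mem_rI (sigIn_ex.1 hB) d e).2 ⟨a, b, ha, he, hab⟩⟩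

theorem ex_mem_conT_iff {T : LiteTBox} {ρ : Role} :
    Basic.ex ρ ∈ conT T ↔ ρ.name ∈ liteTSigR T := by
  cases ρ <;> simp [conT, Role.name]

theorem atom_mem_conT_iff {T : LiteTBox} {P : ℕ} :
    Basic.atom P ∈ conT T ↔ P ∈ liteTSigC T := by
  simp [conT]

theorem mem_conT_of_sig {T : LiteTBox} {ax : LiteAx} (hax : ax ∈ T) {B : Basic}
    (hC : B.sigC ⊆ ax.sigC) (hR : B.sigR ⊆ ax.sigR) : B ∈ conT T := by
  cases B with
  | atom P => exact atom_mem_conT_iff.2 ⟨ax, hax, hC rfl⟩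
  | ex ρ => exact ex_mem_conT_iff.2 ⟨ax, hax, hR rfl⟩

theorem ex_flip_mem_conT {T : LiteTBox} {ρ : Role} (h : Basic.ex ρ ∈ conT T) :
    Basic.ex ρ.flip ∈ conT T := by
  rw [ex_mem_conT_iff] at h ⊢
  simpa using h

theorem liteEntPos_refl (T : LiteTBox) (B : Basic) : liteEntPos T B B :=
  fun _ _ => subset_rfl

theorem liteEntPos.trans {T : LiteTBox} {B₁ B₂ B₃ : Basic} (h : liteEntPos T B₁ B₂)
    (h' : liteEntPos T B₂ B₃) : liteEntPos T B₁ B₃ :=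
  fun I hI => (h I hI).trans (h' I hI)

theorem liteEntPos_ex_of_ri {T : LiteTBox} {ρ σ : Role} (h : LiteAx.ri ρ σ ∈ T) :
    liteEntPos T (.ex ρ) (.ex σ) :=
  fun _ hI _ ⟨e, he⟩ => ⟨e, hI.2.2 ρ σ h he⟩

theorem liteEntPos_ex_flip_of_ri {T : LiteTBox} {ρ σ : Role} (h : LiteAx.ri ρ σ ∈ T) :
    liteEntPos T (.ex ρ.flip) (.ex σ.flip) :=
  fun I hI _ ⟨e, he⟩ =>
    ⟨e, (I.mem_rI_flip σ _ _).2 (hI.2.2 ρ σ h ((I.mem_rI_flip ρ _ _).1 he))⟩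

theorem liteSat.flip {T : LiteTBox} {ρ : Role} (h : liteSat T (.ex ρ)) :
    liteSat T (.ex ρ.flip) := by
  obtain ⟨I, hI, d, e, he⟩ := h
  exact ⟨I, hI, e, d, (I.mem_rI_flip ρ e d).2 he⟩

theorem liteSat.mono {T : LiteTBox} {B₁ B₂ : Basic} (h : liteSat T B₁)
    (h' : liteEntPos T B₁ B₂) : liteSat T B₂ := by
  obtain ⟨I, hI, hne⟩ := h
  exact ⟨I, hI, hne.mono (h' I hI)⟩

theorem IsTType.liteSat {T : LiteTBox} {t : Set Basic} (ht : IsTType T t) {B : Basic}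
    (hB : B ∈ t) : liteSat T B := by
  by_contra h
  refine ht.2.2 B hB B (ht.1 hB) (fun I hI => ?_) hB
  rw [Set.inter_self]
  exact Set.not_nonempty_iff_eq_empty.1 fun hne => h ⟨I, hI, hne⟩

theorem isTType_empty (T : LiteTBox) : IsTType T ∅ :=
  ⟨Set.empty_subset _, fun _ h => h.elim, fun _ h => h.elim⟩

/-- The set of basic concepts of `con(T)` entailed by `B`. -/
def entailedType (T : LiteTBox) (B : Basic) : Set Basic :=
  {C | C ∈ conT T ∧ liteEntPos T B C}

theorem isTType_entailedType {T : LiteTBox} {B : Basic} (h : liteSat T B) :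
    IsTType T (entailedType T B) := by
  refine ⟨fun C hC => hC.1, fun B₁ h₁ B₂ h₂ h₁₂ => ⟨h₂, h₁.2.trans h₁₂⟩, ?_⟩
  intro B₁ h₁ B₂ _ hneg h₂
  obtain ⟨I, hI, d, hd⟩ := h
  exact Set.eq_empty_iff_forall_notMem.1 (hneg I hI) d ⟨h₁.2 I hI hd, h₂.2 I hI hd⟩

/-- The basic concepts of `con(T)` satisfied by an element of a model form a type. -/
theorem isTType_semB {T : LiteTBox} {I : Interp} (hI : I.modelLite T) (d : I.Dom) :
    IsTType T {B | B ∈ conT T ∧ d ∈ I.semB B} := by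
  refine ⟨fun B h => h.1, fun B₁ h₁ B₂ h₂ h => ⟨h₂, h I hI h₁.2⟩, fun B₁ h₁ B₂ _ h h₂ => ?_⟩
  exact Set.eq_empty_iff_forall_notMem.1 (h I hI) d ⟨h₁.2, h₂.2⟩

/-- `∃ρ⁻` entails some basic concept of `con(T)` over the signature. -/
def EntailsClosed (T : LiteTBox) (Sc Sr : Set ℕ) (ρ : Role) : Prop :=
  ∃ B ∈ conT T, sigIn Sc Sr B ∧ liteEntPos T (.ex ρ.flip) B

theorem participating_concat {T : LiteTBox} {Sc Sr : Set ℕ} {rs : List Role} {ρ : Role}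
    (hrs : ∀ σ ∈ rs, ¬ EntailsClosed T Sc Sr σ) (hρ : EntailsClosed T Sc Sr ρ) :
    Participating T Sc Sr (rs ++ [ρ]) := by
  refine ⟨fun i h => ?_, fun σ hσ => ?_⟩
  · have hi : i < rs.length := by simpa using h
    rw [List.getElem_append_left hi]
    exact hrs _ (List.getElem_mem hi)
  · rw [List.getLast?_concat, Option.some_inj] at hσ
    exact hσ ▸ hρ

theorem isPathIn_singleton {T : LiteTBox} {Sr : Set ℕ} {TT : Set (Set Basic)} {t : Set Basic}
    {ρ : Role} (ht : t ∈ TT) (hρt : Basic.ex ρ ∈ t) (hρ : Basic.ex ρ ∈ conT T)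
    (hS : ρ.name ∉ Sr) : IsPathIn T Sr TT t [ρ] := by
  refine ⟨ht, by simp, ?_, ?_, fun i h => by simp at h⟩
  · simpa using ⟨hρ, hS⟩
  · simpa using hρt

theorem IsPathIn.concat {T : LiteTBox} {Sr : Set ℕ} {TT : Set (Set Basic)} {t : Set Basic}
    {rs : List Role} {σ ρ : Role} (h : IsPathIn T Sr TT t (rs ++ [σ]))
    (hρ : Basic.ex ρ ∈ conT T) (hS : ρ.name ∉ Sr)
    (he : liteEntPos T (.ex σ.flip) (.ex ρ)) (hne : σ.flip ≠ ρ) :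
    IsPathIn T Sr TT t (rs ++ [σ] ++ [ρ]) := by
  obtain ⟨ht, -, hmem, hhead, hstep⟩ := h
  refine ⟨ht, by simp, ?_, ?_, ?_⟩
  · intro τ hτ
    rcases List.mem_append.1 hτ with hτ | hτ
    · exact hmem τ hτ
    · rw [List.mem_singleton.1 hτ]
      exact ⟨hρ, hS⟩
  · intro τ hτ
    exact hhead τ (by simpa using hτ)
  · intro i hi
    have hi' : i < (rs ++ [σ]).length := by simp at hi ⊢; omega
    rw [List.getElem_append_left hi']
    by_cases hlt : i + 1 < (rs ++ [σ]).length
    · rw [List.getElem_append_left hlt]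
      exact hstep i hlt
    · obtain rfl : i = rs.length := by simp at hlt hi'; omega
      simpa using ⟨he, hne⟩

/-- The roles ending a path in `TT` none of whose roles leads to a closed basic concept. -/
inductive Generated (T : LiteTBox) (Sc Sr : Set ℕ) (TT : Set (Set Basic)) : Role → Prop
  | base {t : Set Basic} {ρ : Role} : t ∈ TT → Basic.ex ρ ∈ t → Basic.ex ρ ∈ conT T →
      ρ.name ∉ Sr → ¬ EntailsClosed T Sc Sr ρ → Generated T Sc Sr TT ρ
  | step {σ ρ : Role} : Generated T Sc Sr TT σ → liteEntPos T (.ex σ.flip) (.ex ρ) →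
      σ.flip ≠ ρ → Basic.ex ρ ∈ conT T → ρ.name ∉ Sr → ¬ EntailsClosed T Sc Sr ρ →
      Generated T Sc Sr TT ρ

namespace Generated

variable {T : LiteTBox} {Sc Sr : Set ℕ} {TT : Set (Set Basic)} {ρ : Role}

theorem not_entailsClosed (h : Generated T Sc Sr TT ρ) : ¬ EntailsClosed T Sc Sr ρ := by
  cases h <;> assumption

theorem exists_path (h : Generated T Sc Sr TT ρ) :
    ∃ t rs, IsPathIn T Sr TT t (rs ++ [ρ]) ∧ ∀ σ ∈ rs, ¬ EntailsClosed T Sc Sr σ := by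
  induction h with
  | base ht hρt hρ hS _ => exact ⟨_, [], isPathIn_singleton ht hρt hρ hS, by simp⟩
  | step hσ he hne hρ hS _ ih =>
    obtain ⟨t, rs, hp, hrs⟩ := ih
    refine ⟨t, _, hp.concat hρ hS he hne, fun τ hτ => ?_⟩
    rcases List.mem_append.1 hτ with hτ | hτ
    · exact hrs τ hτ
    · rw [List.mem_singleton.1 hτ]
      exact hσ.not_entailsClosed

theorem liteSat (hTT : ∀ t ∈ TT, IsTType T t) (h : Generated T Sc Sr TT ρ) :
    liteSat T (.ex ρ) := by
  induction h with
  | base ht hρt _ _ _ => exact (hTT _ ht).liteSat hρt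
  | step _ he _ _ _ _ ih => exact ih.flip.mono he

end Generated

/-- The type of an element of the canonical model: an individual name of `A` has the type given
by the decoration, a generated role `ρ` stands for an anonymous element with an incoming
`ρ`-edge, and all other elements are isolated. -/
def canonicalType (T : LiteTBox) (Sc Sr : Set ℕ) (A : ABox) (f : ℕ → Set Basic) :
    ℕ ⊕ Role → Set Basic
  | .inl a => {B | a ∈ A.ind ∧ B ∈ f a}
  | .inr ρ => {B | Generated T Sc Sr (f '' A.ind) ρ ∧ B ∈ entailedType T (.ex ρ.flip)}

section canonicalType

variable {T : LiteTBox} {Sc Sr : Set ℕ} {A : ABox} {f : ℕ → Set Basic}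

theorem Decoration.isTType_of_mem_image (hf : Decoration T Sc Sr A f) :
    ∀ t ∈ f '' A.ind, IsTType T t := by
  rintro _ ⟨a, ha, rfl⟩
  exact (hf a ha).1

theorem isTType_canonicalType (hf : Decoration T Sc Sr A f) (d : ℕ ⊕ Role) :
    IsTType T (canonicalType T Sc Sr A f d) := by
  rcases d with a | ρ
  · by_cases ha : a ∈ A.ind
    · simpa [canonicalType, ha] using (hf a ha).1
    · simpa [canonicalType, ha] using isTType_empty T
  · by_cases hρ : Generated T Sc Sr (f '' A.ind) ρ
    · simpa [canonicalType, hρ] using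
        isTType_entailedType (hρ.liteSat hf.isTType_of_mem_image).flip
    · simpa [canonicalType, hρ] using isTType_empty T

theorem mem_canonicalType_of_sigIn (hf : Decoration T Sc Sr A f) {B : Basic}
    (hB : B ∈ conT T) (hS : sigIn Sc Sr B) (d : ℕ ⊕ Role) :
    B ∈ canonicalType T Sc Sr A f d ↔ ∃ a, d = .inl a ∧ A.holdsB B a := by
  rcases d with a | ρ
  · constructor
    · rintro ⟨ha, h⟩
      exact ⟨a, rfl, (((hf a ha).2 B hS).1 h).2⟩
    · rintro ⟨a', h, h'⟩
      obtain rfl := Sum.inl.inj h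
      have ha := ABox.mem_ind_of_holdsB h'
      exact ⟨ha, ((hf a ha).2 B hS).2 ⟨hB, h'⟩⟩
  · constructor
    · rintro ⟨hρ, h⟩
      exact (hρ.not_entailsClosed ⟨B, hB, hS, h.2⟩).elim
    · rintro ⟨a, h, -⟩
      cases h

/-- In a realizable typing, the last role of a path satisfies its inverse existential somewhere. -/
theorem Realizable.exists_mem_canonicalType (hr : Realizable T Sc Sr (f '' A.ind))
    {t : Set Basic} {rs : List Role} {ρ : Role}
    (hp : IsPathIn T Sr (f '' A.ind) t (rs ++ [ρ]))
    (hrs : ∀ σ ∈ rs, ¬ EntailsClosed T Sc Sr σ)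
    (hgen : ¬ EntailsClosed T Sc Sr ρ → Generated T Sc Sr (f '' A.ind) ρ) :
    ∃ e, Basic.ex ρ.flip ∈ canonicalType T Sc Sr A f e := by
  have hρ : Basic.ex ρ.flip ∈ entailedType T (.ex ρ.flip) :=
    ⟨ex_flip_mem_conT (hp.2.2.1 ρ (by simp)).1, liteEntPos_refl T _⟩
  by_cases hc : EntailsClosed T Sc Sr ρ
  · obtain ⟨_, ⟨b, hb, rfl⟩, hu⟩ := hr t _ hp (participating_concat hrs hc) ρ (by simp)
    exact ⟨.inl b, hb, hu hρ⟩
  · exact ⟨.inr ρ, hgen hc, hρ⟩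

theorem exists_flip_mem_canonicalType (hf : Decoration T Sc Sr A f)
    (hr : Realizable T Sc Sr (f '' A.ind)) {ρ : Role} (hS : ρ.name ∉ Sr) {d : ℕ ⊕ Role}
    (hd : Basic.ex ρ ∈ canonicalType T Sc Sr A f d) :
    ∃ e, Basic.ex ρ.flip ∈ canonicalType T Sc Sr A f e := by
  have hρ : Basic.ex ρ ∈ conT T := (isTType_canonicalType hf d).1 hd
  rcases d with a | σ
  · obtain ⟨ha, hd⟩ := hd
    have ha' := Set.mem_image_of_mem f ha
    exact hr.exists_mem_canonicalType (rs := []) (isPathIn_singleton ha' hd hρ hS) (by simp)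
      (.base ha' hd hρ hS)
  · obtain ⟨hσ, -, he⟩ := hd
    by_cases hne : σ.flip = ρ
    · subst hne
      rw [Role.flip_flip]
      cases hσ with
      | base ht hσt _ _ _ =>
        obtain ⟨a, ha, rfl⟩ := ht
        exact ⟨.inl a, ha, hσt⟩
      | step hτ he' _ hσ' _ _ => exact ⟨.inr _, hτ, hσ', he'⟩
    · obtain ⟨t, rs, hp, hrs⟩ := hσ.exists_path
      refine hr.exists_mem_canonicalType (hp.concat hρ hS he hne) (fun τ hτ => ?_)
        (.step hσ he hne hρ hS)
      rcases List.mem_append.1 hτ with hτ | hτ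
      · exact hrs τ hτ
      · rw [List.mem_singleton.1 hτ]
        exact hσ.not_entailsClosed

end canonicalType

/-- The interpretation over individual names and roles in which closed predicates are read off
`A` and all other predicates hold wherever the assignment `ty` of types permits. -/
def typedModel (Sc Sr : Set ℕ) (A : ABox) (ty : ℕ ⊕ Role → Set Basic) : Interp where
  Dom := ℕ ⊕ Role
  dne := ⟨.inl 0⟩
  ind a := some (.inl a)
  ind_inj _ _ _ ha hb := Sum.inl.inj (Option.some.inj (ha.trans hb.symm))
  cInt P := {d | (P ∈ Sc ∧ ∃ a, d = .inl a ∧ (P, a) ∈ A.ca) ∨ (P ∉ Sc ∧ .atom P ∈ ty d)}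
  rInt r := {p | (r ∈ Sr ∧ ∃ a b, p.1 = .inl a ∧ p.2 = .inl b ∧ (r, a, b) ∈ A.ra) ∨
    (r ∉ Sr ∧ .ex (.nm r) ∈ ty p.1 ∧ .ex (.inv r) ∈ ty p.2)}

section typedModel

variable {Sc Sr : Set ℕ} {A : ABox} {ty : ℕ ⊕ Role → Set Basic}

theorem typedModel_ind (a : ℕ) (d : ℕ ⊕ Role) :
    (typedModel Sc Sr A ty).ind a = some d ↔ d = .inl a :=
  Option.some_inj.trans eq_comm

theorem mem_typedModel_cInt (P : ℕ) (d : ℕ ⊕ Role) :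
    d ∈ (typedModel Sc Sr A ty).cInt P ↔
      (P ∈ Sc ∧ ∃ a, d = .inl a ∧ (P, a) ∈ A.ca) ∨ (P ∉ Sc ∧ .atom P ∈ ty d) :=
  Iff.rfl

theorem mem_typedModel_rInt (r : ℕ) (d e : ℕ ⊕ Role) :
    (d, e) ∈ (typedModel Sc Sr A ty).rInt r ↔
      (r ∈ Sr ∧ ∃ a b, d = .inl a ∧ e = .inl b ∧ (r, a, b) ∈ A.ra) ∨
        (r ∉ Sr ∧ .ex (.nm r) ∈ ty d ∧ .ex (.inv r) ∈ ty e) :=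
  Iff.rfl

theorem typedModel_modelA (hA : A.usesOnly Sc Sr) : (typedModel Sc Sr A ty).modelA A :=
  ⟨fun p hp => ⟨_, rfl, .inl ⟨hA.1 p hp, p.2, rfl, hp⟩⟩,
    fun t ht => ⟨_, _, rfl, rfl, .inl ⟨hA.2 t ht, t.2.1, t.2.2, rfl, rfl, ht⟩⟩⟩

theorem typedModel_respects : (typedModel Sc Sr A ty).respects A Sc Sr := by
  constructor
  · intro P hP d
    refine ((mem_typedModel_cInt P d).trans (or_iff_left fun h => h.1 hP)).trans ?_
    rw [and_iff_right hP]
    exact exists_congr fun a => and_congr_left fun _ => (typedModel_ind a d).symm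
  · intro r hr d e
    refine ((mem_typedModel_rInt r d e).trans (or_iff_left fun h => h.1 hr)).trans ?_
    rw [and_iff_right hr]
    exact exists₂_congr fun a b =>
      and_congr (typedModel_ind a d).symm (and_congr_left fun _ => (typedModel_ind b e).symm)

theorem mem_typedModel_rI {ρ : Role} (hρ : ρ.name ∉ Sr) (d e : ℕ ⊕ Role) :
    (d, e) ∈ (typedModel Sc Sr A ty).rI ρ ↔ .ex ρ ∈ ty d ∧ .ex ρ.flip ∈ ty e := by
  cases ρ with
  | nm r =>
    have hr : r ∉ Sr := hρ
    refine (mem_typedModel_rInt r d e).trans ?_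
    simp [hr, Role.flip]
  | inv r =>
    have hr : r ∉ Sr := hρ
    refine (mem_typedModel_rInt (Sc := Sc) r e d).trans ?_
    simp [hr, Role.flip, and_comm]

theorem mem_typedModel_semB {T : LiteTBox} (hA : A.usesOnly Sc Sr)
    (hclosed : ∀ B ∈ conT T, sigIn Sc Sr B → ∀ d,
      B ∈ ty d ↔ ∃ a, d = .inl a ∧ A.holdsB B a)
    (hwit : ∀ ρ : Role, ρ.name ∉ Sr → ∀ d, .ex ρ ∈ ty d → ∃ e, .ex ρ.flip ∈ ty e)
    {B : Basic} (hB : B ∈ conT T) (d : ℕ ⊕ Role) :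
    d ∈ (typedModel Sc Sr A ty).semB B ↔ B ∈ ty d := by
  by_cases hS : sigIn Sc Sr B
  · rw [hclosed B hB hS]
    exact (typedModel_respects.mem_semB (typedModel_modelA hA) hS d).trans
      (exists_congr fun a => and_congr_left fun _ => typedModel_ind a d)
  · cases B with
    | atom P =>
      have hP : P ∉ Sc := fun h => hS (sigIn_atom.2 h)
      refine (mem_typedModel_cInt P d).trans ?_
      simp [hP]
    | ex ρ =>
      have hρ : ρ.name ∉ Sr := fun h => hS (sigIn_ex.2 h)
      constructor
      · rintro ⟨e, he⟩
        exact ((mem_typedModel_rI hρ d e).1 he).1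
      · intro h
        obtain ⟨e, he⟩ := hwit ρ hρ d h
        exact ⟨e, (mem_typedModel_rI hρ d e).2 ⟨h, he⟩⟩

theorem typedModel_modelLite {T : LiteTBox} (hA : A.usesOnly Sc Sr)
    (hri : ∀ ρ σ : Role, LiteAx.ri ρ σ ∈ T → σ.name ∈ Sr → ρ.name ∈ Sr)
    (hsub : ∀ ρ σ : Role, LiteAx.ri ρ σ ∈ T → ρ.name ∈ Sr → σ.name ∈ Sr →
      ∀ a b : ℕ, A.holdsR ρ a b → A.holdsR σ a b)
    (htype : ∀ d, IsTType T (ty d))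
    (hclosed : ∀ B ∈ conT T, sigIn Sc Sr B → ∀ d,
      B ∈ ty d ↔ ∃ a, d = .inl a ∧ A.holdsB B a)
    (hwit : ∀ ρ : Role, ρ.name ∉ Sr → ∀ d, .ex ρ ∈ ty d → ∃ e, .ex ρ.flip ∈ ty e) :
    (typedModel Sc Sr A ty).modelLite T := by
  have hsem {B : Basic} (hB : B ∈ conT T) (d : ℕ ⊕ Role) :
      d ∈ (typedModel Sc Sr A ty).semB B ↔ B ∈ ty d :=
    mem_typedModel_semB hA hclosed hwit hB d
  refine ⟨fun B₁ B₂ h d hd => ?_, fun B₁ B₂ h => ?_, fun ρ σ h => ?_⟩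
  · have h₁ : B₁ ∈ conT T :=
      mem_conT_of_sig h Set.subset_union_left Set.subset_union_left
    have h₂ : B₂ ∈ conT T :=
      mem_conT_of_sig h Set.subset_union_right Set.subset_union_right
    exact (hsem h₂ d).2 ((htype d).2.1 B₁ ((hsem h₁ d).1 hd) B₂ h₂ fun I hI => hI.1 B₁ B₂ h)
  · have h₁ : B₁ ∈ conT T :=
      mem_conT_of_sig h Set.subset_union_left Set.subset_union_left
    have h₂ : B₂ ∈ conT T :=
      mem_conT_of_sig h Set.subset_union_right Set.subset_union_right
    refine Set.eq_empty_iff_forall_notMem.2 fun d hd => ?_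
    exact (htype d).2.2 B₁ ((hsem h₁ d).1 hd.1) B₂ h₂ (fun I hI => hI.2.1 B₁ B₂ h)
      ((hsem h₂ d).1 hd.2)
  · have h₁ : Basic.ex ρ ∈ conT T :=
      ex_mem_conT_iff.2 ⟨_, h, .inl rfl⟩
    have h₂ : Basic.ex σ ∈ conT T :=
      ex_mem_conT_iff.2 ⟨_, h, .inr rfl⟩
    rintro ⟨d, e⟩ hde
    by_cases hσ : σ.name ∈ Sr
    · have hρ := hri ρ σ h hσ
      obtain ⟨a, b, ha, hb, hab⟩ := (typedModel_respects.mem_rI hρ d e).1 hde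
      exact (typedModel_respects.mem_rI hσ d e).2 ⟨a, b, ha, hb, hsub ρ σ h hρ hσ a b hab⟩
    · have hd : Basic.ex ρ ∈ ty d := (hsem h₁ d).1 ⟨e, hde⟩
      have he : Basic.ex ρ.flip ∈ ty e :=
        (hsem (ex_flip_mem_conT h₁) e).1 ⟨d, (Interp.mem_rI_flip _ ρ e d).2 hde⟩
      exact (mem_typedModel_rI hσ d e).2
        ⟨(htype d).2.1 _ hd _ h₂ (liteEntPos_ex_of_ri h),
          (htype e).2.1 _ he _ (ex_flip_mem_conT h₂) (liteEntPos_ex_flip_of_ri h)⟩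

end typedModel

/-- The decoration of an ABox induced by one of its models. -/
def inducedType (T : LiteTBox) (I : Interp) (a : ℕ) : Set Basic :=
  {B | B ∈ conT T ∧ ∃ d, I.ind a = some d ∧ d ∈ I.semB B}

theorem inducedType_eq {T : LiteTBox} {I : Interp} {a : ℕ} {d : I.Dom} (h : I.ind a = some d) :
    inducedType T I a = {B | B ∈ conT T ∧ d ∈ I.semB B} := by
  simp [inducedType, h]

section inducedType

variable {T : LiteTBox} {Sc Sr : Set ℕ} {A : ABox} {I : Interp}

theorem decoration_inducedType (hT : I.modelLite T) (hA : I.modelA A)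
    (hS : I.respects A Sc Sr) : Decoration T Sc Sr A (inducedType T I) := by
  intro a ha
  obtain ⟨d, hd⟩ := hA.ind_of_mem ha
  rw [inducedType_eq hd]
  refine ⟨isTType_semB hT d, fun B hB => and_congr_right fun _ => ?_⟩
  rw [hS.mem_semB hA hB]
  constructor
  · rintro ⟨a', ha', h⟩
    rwa [I.ind_inj a a' d hd ha']
  · exact fun h => ⟨a, hd, h⟩

/-- Every path starting from the type of an individual can be followed in the model. -/
theorem IsPathIn.exists_semB (hT : I.modelLite T) {t : Set Basic} {rs : List Role}
    (hp : IsPathIn T Sr (inducedType T I '' A.ind) t rs) (i : ℕ) (hi : i < rs.length) :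
    ∃ d, d ∈ I.semB (.ex rs[i].flip) := by
  have key (ρ : Role) (h : ∃ d, d ∈ I.semB (.ex ρ)) : ∃ d, d ∈ I.semB (.ex ρ.flip) := by
    obtain ⟨d, e, he⟩ := h
    exact ⟨e, d, (I.mem_rI_flip ρ e d).2 he⟩
  apply key
  induction i with
  | zero =>
    obtain ⟨⟨a, -, rfl⟩, -, -, hhead, -⟩ := hp
    obtain ⟨-, d, -, hd⟩ := hhead rs[0] (by rw [List.head?_eq_getElem?]; simp [hi])
    exact ⟨d, hd⟩
  | succ i ih =>
    obtain ⟨d, hd⟩ := key _ (ih (by omega))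
    exact ⟨d, (hp.2.2.2.2 i hi).1 I hT hd⟩

theorem realizable_inducedType (hT : I.modelLite T) (hA : I.modelA A)
    (hS : I.respects A Sc Sr) : Realizable T Sc Sr (inducedType T I '' A.ind) := by
  intro t rs hp hpart ρ hρ
  obtain ⟨d, hd⟩ : ∃ d, d ∈ I.semB (.ex ρ.flip) := by
    obtain ⟨i, hi, rfl⟩ := List.getElem_of_mem (List.mem_of_getLast? hρ)
    exact hp.exists_semB hT i hi
  obtain ⟨B, -, hBS, hB⟩ := hpart.2 ρ hρ
  obtain ⟨a, ha, haB⟩ := (hS.mem_semB hA hBS d).1 (hB I hT hd)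
  refine ⟨_, ⟨a, ABox.mem_ind_of_holdsB haB, rfl⟩, fun C hC => ?_⟩
  exact ⟨hC.1, d, ha, hC.2 I hT hd⟩

end inducedType

/-- Let `T` be a DL-Lite_R TBox containing no role inclusion
`s ⊑ r` with `sig(s) ⊄ S` and `sig(r) ⊆ S`, where `S = (Sc, Sr)` is a
signature.  Then an `S`-ABox `A` is consistent w.r.t. `(T, S)` iff
(1) `A` has a `T`-decoration whose image is an `S`-realizable `T`-typing, and
(2) `s(a,b) ∈ A` and `s ⊑ r ∈ R_S` implies `r(a,b) ∈ A`. -/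
theorem statement_19 (T : LiteTBox) (Sc Sr : Set ℕ)
    (hfin : Sc.Finite ∧ Sr.Finite)
    (hri : ∀ ρ σ : Role, LiteAx.ri ρ σ ∈ T → σ.name ∈ Sr → ρ.name ∈ Sr)
    (A : ABox) (hA : A.Fin) (hAS : A.usesOnly Sc Sr) :
    consistentW (fun I => I.modelLite T) Sc Sr A ↔
      ((∃ f : ℕ → Set Basic,
          Decoration T Sc Sr A f ∧ Realizable T Sc Sr (f '' A.ind)) ∧
       (∀ ρ σ : Role, liteEntRI T ρ σ → ρ.name ∈ Sr → σ.name ∈ Sr →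
         ∀ a b : ℕ, A.holdsR ρ a b → A.holdsR σ a b)) := by
  constructor
  · rintro ⟨I, hT, hIA, hIS⟩
    refine ⟨⟨inducedType T I, decoration_inducedType hT hIA hIS,
      realizable_inducedType hT hIA hIS⟩, fun ρ σ hρσ hρ hσ a b hab => ?_⟩
    obtain ⟨d, hd⟩ := hIA.ind_of_mem (ABox.mem_ind_of_holdsR hab).1
    obtain ⟨e, he⟩ := hIA.ind_of_mem (ABox.mem_ind_of_holdsR hab).2
    obtain ⟨a', b', ha', hb', h⟩ := (hIS.mem_rI hσ d e).1
      (hρσ I hT ((hIS.mem_rI hρ d e).2 ⟨a, b, hd, he, hab⟩))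
    rwa [I.ind_inj a a' d hd ha', I.ind_inj b b' e he hb']
  · rintro ⟨⟨f, hf, hr⟩, hsub⟩
    refine ⟨typedModel Sc Sr A (canonicalType T Sc Sr A f), ?_, typedModel_modelA hAS,
      typedModel_respects⟩
    exact typedModel_modelLite hAS hri (fun ρ σ h => hsub ρ σ fun I hI => hI.2.2 ρ σ h)
      (isTType_canonicalType hf) (fun B => mem_canonicalType_of_sigIn hf)
      (fun ρ hρ d => exists_flip_mem_canonicalType hf hr hρ)

end DL
end
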